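/- Let B = P^{coH} ⊆ P be a faithfully flat Hopf–Galois extension. Define Z̃¹(H,P) as the set of unital right H-colinear maps f: H → P (with H a right H-comodule via the right adjoint coaction h ↦ h₍₂₎ ⊗ (Sh₍₁₎)h₍₃₎) satisfying p₍₀₎q₍₀₎ f(p₍₁₎q₍₁₎) = p₍₀₎ f(p₍₁₎) q₍₀₎ f(q₍₁₎) for all p,q ∈ P. Then Z̃¹(H,P) is a group under convolution with inverse f⁻¹(h) = h₍₂₎⁽¹⁾ f(Sh₍₁₎) h₍₂₎⁽²⁾, and Z¹(L(P,H),B) ≅ Z̃¹(H,P) as groups. -/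

import Mathlib

open scoped TensorProduct
open TensorProduct

noncomputable section
attribute [local instance] Classical.propDecidable

/-- Choice-based lift of a (bilinear) function to the tensor product: if a linear map agreeing
with `f` on pure tensors exists, this is it (it is then unique); otherwise `0`. -/
def tlift (R : Type*) [CommRing R] {M N Q : Type*} [AddCommGroup M] [Module R M]
    [AddCommGroup N] [Module R N] [AddCommGroup Q] [Module R Q]
    (f : M → N → Q) : M ⊗[R] N →ₗ[R] Q :=
  if h : ∃ F : M ⊗[R] N →ₗ[R] Q, ∀ x y, F (x ⊗ₜ[R] y) = f x y then h.choose else 0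

/-- Choice-based lift of a (bilinear, balanced) function to a quotient of the tensor product. -/
def qtlift (R : Type*) [CommRing R] {M N Q : Type*} [AddCommGroup M] [Module R M]
    [AddCommGroup N] [Module R N] [AddCommGroup Q] [Module R Q]
    (p : Submodule R (M ⊗[R] N)) (f : M → N → Q) : ((M ⊗[R] N) ⧸ p) →ₗ[R] Q :=
  if h : ∃ F : ((M ⊗[R] N) ⧸ p) →ₗ[R] Q,
      ∀ x y, F (Submodule.Quotient.mk (x ⊗ₜ[R] y)) = f x y then h.choose else 0

variable (k : Type*) [Field k]

/-- Source and target data for a left bialgebroid over `B`: an algebra map `s : B → L` and an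
anti-algebra map `t : B → L` with commuting ranges. -/
structure BgdST (B L : Type*) [Ring B] [Algebra k B] [Ring L] [Algebra k L] where
  s : B →ₐ[k] L
  t : B →ₗ[k] L
  t_one : t 1 = 1
  t_mul : ∀ a b : B, t (a * b) = t b * t a
  st_comm : ∀ a b : B, s a * t b = t b * s a

namespace BgdST

variable {k} {B L : Type*} [Ring B] [Algebra k B] [Ring L] [Algebra k L]
variable (st : BgdST k B L)

/-- The relations defining `L ⊗_B L`: `t a · X ⊗ Y  ~  X ⊗ s a · Y`. -/
def rel : Submodule k (L ⊗[k] L) :=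
  Submodule.span k {z | ∃ (a : B) (X Y : L), z = (st.t a * X) ⊗ₜ[k] Y - X ⊗ₜ[k] (st.s a * Y)}

/-- `L ⊗_B L` (the coring tensor square). -/
abbrev T2 := (L ⊗[k] L) ⧸ st.rel

/-- Class of a pure tensor in `L ⊗_B L`. -/
def mk2 (X Y : L) : st.T2 := Submodule.Quotient.mk (X ⊗ₜ[k] Y)

/-- Evaluate a balanced bilinear expression on an element of `L ⊗_B L`. -/
def lift2 {Q : Type*} [AddCommGroup Q] [Module k Q] (f : L → L → Q) : st.T2 →ₗ[k] Q :=
  qtlift k st.rel f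

/-- The relations defining `L ⊗_{B^{op}} L`: `X·t a ⊗ Y ~ X ⊗ t a · Y`. -/
def relOp : Submodule k (L ⊗[k] L) :=
  Submodule.span k {z | ∃ (a : B) (X Y : L), z = (X * st.t a) ⊗ₜ[k] Y - X ⊗ₜ[k] (st.t a * Y)}

/-- `L ⊗_{B^{op}} L` (domain of the canonical map `λ`). -/
abbrev TOp := (L ⊗[k] L) ⧸ st.relOp

def mkOp (X Y : L) : st.TOp := Submodule.Quotient.mk (X ⊗ₜ[k] Y)

def liftOp {Q : Type*} [AddCommGroup Q] [Module k Q] (f : L → L → Q) : st.TOp →ₗ[k] Q :=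
  qtlift k st.relOp f

/-- The relations defining `L ⊗^{B^{op}} L`: `s a · X ⊗ Y ~ X ⊗ Y · s a`. -/
def relA : Submodule k (L ⊗[k] L) :=
  Submodule.span k {z | ∃ (a : B) (X Y : L), z = (st.s a * X) ⊗ₜ[k] Y - X ⊗ₜ[k] (Y * st.s a)}

/-- `L ⊗^{B^{op}} L` (domain of the canonical map `μ`). -/
abbrev TA := (L ⊗[k] L) ⧸ st.relA

def mkA (X Y : L) : st.TA := Submodule.Quotient.mk (X ⊗ₜ[k] Y)

def liftA {Q : Type*} [AddCommGroup Q] [Module k Q] (f : L → L → Q) : st.TA →ₗ[k] Q :=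
  qtlift k st.relA f

/-- Relations for the triple tensor `L ⊗_B L ⊗_B L`. -/
def rel3 : Submodule k (L ⊗[k] (L ⊗[k] L)) :=
  Submodule.span k
    ({z | ∃ (a : B) (X Y Z : L),
        z = (st.t a * X) ⊗ₜ[k] (Y ⊗ₜ[k] Z) - X ⊗ₜ[k] ((st.s a * Y) ⊗ₜ[k] Z)} ∪
     {z | ∃ (a : B) (X Y Z : L),
        z = X ⊗ₜ[k] ((st.t a * Y) ⊗ₜ[k] Z) - X ⊗ₜ[k] (Y ⊗ₜ[k] (st.s a * Z))})

/-- `L ⊗_B L ⊗_B L`. -/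
abbrev T3 := (L ⊗[k] (L ⊗[k] L)) ⧸ st.rel3

def mk3 (X Y Z : L) : st.T3 := Submodule.Quotient.mk (X ⊗ₜ[k] (Y ⊗ₜ[k] Z))

/-- The factorwise product of two elements of `L ⊗_B L`, whenever it is well defined
on representatives (as it is when the left factor lies in the Takeuchi product);
junk value `0` otherwise. -/
def mulT2 (z w : st.T2) : st.T2 :=
  if h : ∃ u : st.T2, ∀ zr wr : L ⊗[k] L, Submodule.Quotient.mk zr = z →
      Submodule.Quotient.mk wr = w → Submodule.Quotient.mk (zr * wr) = u
  then h.choose else 0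

variable (cop : L →ₗ[k] st.T2) (cou : L →ₗ[k] B)

/-- The axioms of a left bialgebroid over `B` with structure `(s,t,Δ,ε) = (st.s, st.t, cop, cou)`
(Definition 2.3 of the paper): `L` is a `B^e`-ring and a `B`-coring, the coproduct corestricts
to an algebra map into the Takeuchi product, and the counit is a left character. -/
structure IsLeftBialgebroid : Prop where
  comul_one : cop 1 = st.mk2 1 1
  comul_mul : ∀ X Y : L, cop (X * Y) = st.mulT2 (cop X) (cop Y)
  comul_s : ∀ (b : B) (X : L),
    cop (st.s b * X) = st.lift2 (fun x y => st.mk2 (st.s b * x) y) (cop X)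
  comul_t : ∀ (b : B) (X : L),
    cop (st.t b * X) = st.lift2 (fun x y => st.mk2 x (st.t b * y)) (cop X)
  takeuchi : ∀ (b : B) (X : L),
    st.lift2 (fun x y => st.mk2 (x * st.t b) y) (cop X) =
      st.lift2 (fun x y => st.mk2 x (y * st.s b)) (cop X)
  coassoc : ∀ X : L,
    st.lift2 (fun x1 x2 => st.lift2 (fun y1 y2 => st.mk3 x1 y1 y2) (cop x2)) (cop X) =
      st.lift2 (fun x12 x3 => st.lift2 (fun x1 x2 => st.mk3 x1 x2 x3) (cop x12)) (cop X)
  counit_comul_left : ∀ X : L, st.lift2 (fun x1 x2 => st.s (cou x1) * x2) (cop X) = X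
  counit_comul_right : ∀ X : L, st.lift2 (fun x1 x2 => st.t (cou x2) * x1) (cop X) = X
  counit_one : cou 1 = 1
  counit_s : ∀ (b : B) (X : L), cou (st.s b * X) = b * cou X
  counit_t : ∀ (b : B) (X : L), cou (st.t b * X) = cou X * b
  counit_char_s : ∀ X Y : L, cou (X * st.s (cou Y)) = cou (X * Y)
  counit_char_t : ∀ X Y : L, cou (X * st.t (cou Y)) = cou (X * Y)

/-- The canonical map `λ : L ⊗_{B^{op}} L → L ⊗_B L`, `X ⊗ Y ↦ X₍₁₎ ⊗ X₍₂₎Y`. -/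
def lam : st.TOp →ₗ[k] st.T2 :=
  st.liftOp (fun X Y => st.lift2 (fun x1 x2 => st.mk2 x1 (x2 * Y)) (cop X))

/-- A left bialgebroid is a left Hopf algebroid if `λ` is bijective. -/
def IsLeftHopf : Prop := Function.Bijective (st.lam cop)

/-- The canonical map `μ : L ⊗^{B^{op}} L → L ⊗_B L`, `X ⊗ Y ↦ Y₍₁₎X ⊗ Y₍₂₎`. -/
def mu : st.TA →ₗ[k] st.T2 :=
  st.liftA (fun X Y => st.lift2 (fun y1 y2 => st.mk2 (y1 * X) y2) (cop Y))

/-- A left bialgebroid is an anti-left Hopf algebroid if `μ` is bijective. -/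
def IsAntiLeftHopf : Prop := Function.Bijective (st.mu cop)

/-- `X₊ ⊗_{B^{op}} X₋ := λ⁻¹(X ⊗_B 1)` (meaningful when `λ` is bijective). -/
def plusMinus (X : L) : st.TOp := Function.invFun (st.lam cop) (st.mk2 X 1)

/-- `X₍₋₎ ⊗^{B^{op}} X₍₊₎ := μ⁻¹(1 ⊗_B X)` (meaningful when `μ` is bijective). -/
def minusPlus (X : L) : st.TA := Function.invFun (st.mu cop) (st.mk2 1 X)

/-- A left bisection of a left bialgebroid (Definition 3.1). -/
structure IsLeftBisection (σ : L →ₗ[k] B) : Prop where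
  unital : σ 1 = 1
  t_prop : ∀ (b : B) (X : L), σ (st.t b * X) = σ X * b
  s_mul : ∀ a b : B, σ (st.s (a * b)) = σ (st.s a) * σ (st.s b)
  s_bij : Function.Bijective (fun b => σ (st.s b))
  prod_t : ∀ X Y : L, σ (X * Y) = σ (X * st.t (σ Y))
  prod_s : ∀ X Y : L,
    σ (X * Y) = σ (X * st.s (Function.invFun (fun b => σ (st.s b)) (σ Y)))

/-- Convolution of left bisections:  `(σ * η)(X) := σ(s(η(X₍₁₎)) X₍₂₎)`. -/
def bconv (σ η : L →ₗ[k] B) : L →ₗ[k] B :=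
  (st.lift2 (fun x1 x2 => σ (st.s (η x1) * x2))).comp cop

/-- A right bisection of a left bialgebroid (Definition 3.6). -/
structure IsRightBisection (σ : L →ₗ[k] B) : Prop where
  unital : σ 1 = 1
  s_prop : ∀ (b : B) (X : L), σ (st.s b * X) = b * σ X
  t_mul : ∀ a b : B, σ (st.t (a * b)) = σ (st.t b) * σ (st.t a)
  t_bij : Function.Bijective (fun b => σ (st.t b))
  prod_s : ∀ X Y : L, σ (X * Y) = σ (X * st.s (σ Y))
  prod_t : ∀ X Y : L,
    σ (X * Y) = σ (X * st.t (Function.invFun (fun b => σ (st.t b)) (σ Y)))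

/-- Convolution of right bisections:  `(σ • η)(X) := σ(t(η(X₍₂₎)) X₍₁₎)`. -/
def rconv (σ η : L →ₗ[k] B) : L →ₗ[k] B :=
  (st.lift2 (fun x1 x2 => σ (st.t (η x2) * x1))).comp cop

/-- An automorphism `(Φ, φ)` of a left bialgebroid. -/
structure IsBgdAut (Φ : L →ₐ[k] L) (φ : B →ₐ[k] B) : Prop where
  bijL : Function.Bijective Φ
  bijB : Function.Bijective φ
  comp_s : ∀ b : B, Φ (st.s b) = st.s (φ b)
  comp_t : ∀ b : B, Φ (st.t b) = st.t (φ b)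
  comp_comul : ∀ X : L,
    cop (Φ X) = st.lift2 (fun x1 x2 => st.mk2 (Φ x1) (Φ x2)) (cop X)
  comp_counit : ∀ X : L, cou (Φ X) = φ (cou X)

/-- `Ad^L_σ(X) := s(σ(X₍₁₎)) X₍₂₎₊ t(σ(X₍₂₎₋))`, for a left Hopf algebroid. -/
def adL (σ : L →ₗ[k] B) (X : L) : L :=
  st.lift2 (fun x1 x2 => st.s (σ x1) *
    st.liftOp (fun p m => p * st.t (σ m)) (st.plusMinus cop x2)) (cop X)

/-- `Ad^R_σ(X) := t(σ(X₍₂₎)) X₍₁₎₍₊₎ s(σ(X₍₁₎₍₋₎))`, for an anti-left Hopf algebroid. -/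
def adR (σ : L →ₗ[k] B) (X : L) : L :=
  st.lift2 (fun x1 x2 => st.t (σ x2) *
    st.liftA (fun m p => p * st.s (σ m)) (st.minusPlus cop x1)) (cop X)

/-- The `B`-bimodule-map conditions on a map `L → B` used for `C¹(L,B)`. -/
def IsBimodMap (U : L →ₗ[k] B) : Prop :=
  (∀ (b : B) (X : L), U (st.t b * X) = U X * b) ∧
  (∀ (b : B) (X : L), U (st.s b * X) = b * U X)

/-- Convolution `(U * V)(X) = U(X₍₁₎) V(X₍₂₎)` of `B`-valued maps. -/
def cconv (U V : L →ₗ[k] B) : L →ₗ[k] B :=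
  (st.lift2 (fun x1 x2 => U x1 * V x2)).comp cop

/-- Extended vertical bisections `C¹(L,B)`: unital convolution-invertible `B`-bimodule maps
`U : L → B` with `U(X s(b)) = U(X t(b))`. -/
def IsC1 (U : L →ₗ[k] B) : Prop :=
  U 1 = 1 ∧ st.IsBimodMap U ∧
  (∀ (b : B) (X : L), U (X * st.s b) = U (X * st.t b)) ∧
  ∃ V : L →ₗ[k] B, st.IsBimodMap V ∧ st.cconv cop U V = cou ∧ st.cconv cop V U = cou

/-- Convolution product on `B`-bimodule maps `L ⊗_{B^e} L → B`:
`(f ⋆ g)(X,Y) = f(X₍₁₎,Y₍₁₎) g(X₍₂₎,Y₍₂₎)`. -/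
def conv2 (f g : L → L → B) (X Y : L) : B :=
  st.lift2 (fun y1 y2 =>
    st.lift2 (fun x1 x2 => f x1 y1 * g x2 y2) (cop X)) (cop Y)

/-- The unit `ε̃(X ⊗ Y) = ε(XY)` of the convolution algebra. -/
def unit2 (X Y : L) : B := cou (X * Y)

/-- Left-hand side of the 2-cocycle condition: `Γ(X, s(Γ(Y₍₁₎,Z₍₁₎)) Y₍₂₎Z₍₂₎)`. -/
def cocL (Γ : L → L → B) (X Y Z : L) : B :=
  st.lift2 (fun z1 z2 =>
    st.lift2 (fun y1 y2 => Γ X (st.s (Γ y1 z1) * (y2 * z2))) (cop Y)) (cop Z)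

/-- Right-hand side of the 2-cocycle condition: `Γ(s(Γ(X₍₁₎,Y₍₁₎)) X₍₂₎Y₍₂₎, Z)`. -/
def cocR (Γ : L → L → B) (X Y Z : L) : B :=
  st.lift2 (fun y1 y2 =>
    st.lift2 (fun x1 x2 => Γ (st.s (Γ x1 y1) * (x2 * y2)) Z) (cop X)) (cop Y)

/-- Membership of a bilinear map in `_B Hom_B (L ⊗_{B^e} L, B)`. -/
def IsBihom (Γ : L → L → B) : Prop :=
  (∃ Γ' : L →ₗ[k] L →ₗ[k] B, ∀ X Y, Γ' X Y = Γ X Y) ∧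
  (∀ (b c : B) (X Y : L), Γ (st.s b * (st.t c * X)) Y = b * Γ X Y * c) ∧
  (∀ (b c : B) (X Y : L), Γ (X * st.s b * st.t c) Y = Γ X (st.s b * (st.t c * Y)))

/-- An invertible normalised 2-cocycle on a left bialgebroid (Definition 2.6);
the collection of these is `Z²(L,B)`. -/
structure IsZ2 (Γ : L → L → B) : Prop where
  bihom : st.IsBihom Γ
  norm_left : ∀ X : L, Γ 1 X = cou X
  norm_right : ∀ X : L, Γ X 1 = cou X
  st_indep : ∀ (b : B) (X Y : L), Γ X (Y * st.s b) = Γ X (Y * st.t b)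
  cocycle : ∀ X Y Z : L, st.cocL cop Γ X Y Z = st.cocR cop Γ X Y Z
  inv : ∃ Γi : L → L → B, st.IsBihom Γi ∧
    (∀ X Y, st.conv2 cop Γ Γi X Y = unit2 cou X Y) ∧
    (∀ X Y, st.conv2 cop Γi Γ X Y = unit2 cou X Y)

/-- The coboundary `∂U(X,Y) = U⁻¹(X₍₁₎ t(U⁻¹(Y₍₁₎))) U(X₍₂₎Y₍₂₎)` of `U ∈ C¹(L,B)`. -/
def coboundary (U Ui : L →ₗ[k] B) (X Y : L) : B :=
  st.lift2 (fun y1 y2 =>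
    st.lift2 (fun x1 x2 => Ui (x1 * st.t (Ui y1)) * U (x2 * y2)) (cop X)) (cop Y)

/-- The transform `Γ^U(X,Y) = U⁻¹(X₍₁₎ t(U⁻¹(Y₍₁₎))) Γ(X₍₂₎,Y₍₂₎) U(X₍₃₎Y₍₃₎)`. -/
def gammaU (Γ : L → L → B) (U Ui : L →ₗ[k] B) (X Y : L) : B :=
  st.lift2 (fun y1 y23 => st.lift2 (fun y2 y3 =>
    st.lift2 (fun x1 x23 => st.lift2 (fun x2 x3 =>
      Ui (x1 * st.t (Ui y1)) * Γ x2 y2 * U (x3 * y3)) (cop x23)) (cop X))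
    (cop y23)) (cop Y)

/-- The cotwisted product `X ·_Γ Y := s(Γ(X₍₁₎,Y₍₁₎)) t(Γ⁻¹(X₍₃₎,Y₍₃₎)) X₍₂₎Y₍₂₎`. -/
def prodG (Γ Γi : L → L → B) (X Y : L) : L :=
  st.lift2 (fun y1 y23 => st.lift2 (fun y2 y3 =>
    st.lift2 (fun x1 x23 => st.lift2 (fun x2 x3 =>
      st.s (Γ x1 y1) * (st.t (Γi x3 y3) * (x2 * y2))) (cop x23)) (cop X))
    (cop y23)) (cop Y)

/-- `Ad_U(X) := s(U(X₍₁₎)) t(U⁻¹(X₍₃₎)) X₍₂₎`. -/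
def adU (U Ui : L →ₗ[k] B) (X : L) : L :=
  st.lift2 (fun x1 x23 => st.lift2 (fun x2 x3 =>
    st.s (U x1) * (st.t (Ui x3) * x2)) (cop x23)) (cop X)

end BgdST

end

/-! ## Hopf–Galois extensions and the Ehresmann–Schauenburg bialgebroid -/

noncomputable section
attribute [local instance] Classical.propDecidable

universe u v

open scoped TensorProduct
open TensorProduct

variable {k : Type u} [Field k] {H P : Type v} [Ring H] [HopfAlgebra k H]
  [Ring P] [Algebra k P]

/-- A right `H`-comodule algebra structure on `P`. -/
structure ComodAlg (k : Type u) [Field k] (H P : Type v) [Ring H] [HopfAlgebra k H]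
    [Ring P] [Algebra k P] where
  ρ : P →ₗ[k] P ⊗[k] H
  coassoc : ∀ p : P,
    tlift k (fun p0 p1 => p0 ⊗ₜ[k] (Coalgebra.comul (R := k) p1)) (ρ p) =
      tlift k (fun p0 p1 =>
        tlift k (fun q0 q1 => (q0 ⊗ₜ[k] (q1 ⊗ₜ[k] p1) : P ⊗[k] (H ⊗[k] H))) (ρ p0)) (ρ p)
  counit_coact : ∀ p : P,
    tlift k (fun p0 p1 => (Coalgebra.counit (R := k) p1 : k) • p0) (ρ p) = p
  coact_mul : ∀ p q : P, ρ (p * q) = ρ p * ρ q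
  coact_one : ρ 1 = 1

namespace ComodAlg

variable (ca : ComodAlg k H P)

/-- The subalgebra `B = P^{coH}` of coinvariants. -/
def coinv : Subalgebra k P where
  carrier := {p : P | ca.ρ p = p ⊗ₜ[k] (1 : H)}
  mul_mem' := by
    intro a b ha hb
    have ha' : ca.ρ a = a ⊗ₜ[k] (1 : H) := ha
    have hb' : ca.ρ b = b ⊗ₜ[k] (1 : H) := hb
    show ca.ρ (a * b) = (a * b) ⊗ₜ[k] (1 : H)
    rw [ca.coact_mul, ha', hb', Algebra.TensorProduct.tmul_mul_tmul, one_mul]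
  one_mem' := by
    show ca.ρ 1 = (1 : P) ⊗ₜ[k] (1 : H)
    rw [ca.coact_one, Algebra.TensorProduct.one_def]
  add_mem' := by
    intro a b ha hb
    have ha' : ca.ρ a = a ⊗ₜ[k] (1 : H) := ha
    have hb' : ca.ρ b = b ⊗ₜ[k] (1 : H) := hb
    show ca.ρ (a + b) = (a + b) ⊗ₜ[k] (1 : H)
    rw [map_add, ha', hb', TensorProduct.add_tmul]
  algebraMap_mem' := by
    intro r
    show ca.ρ (algebraMap k P r) = (algebraMap k P r) ⊗ₜ[k] (1 : H)
    rw [Algebra.algebraMap_eq_smul_one, map_smul, ca.coact_one, Algebra.TensorProduct.one_def,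
      TensorProduct.smul_tmul']

/-- The relations defining `P ⊗_B P` over the coinvariants. -/
def relB : Submodule k (P ⊗[k] P) :=
  Submodule.span k {z | ∃ (p q b : P), ca.ρ b = b ⊗ₜ[k] (1 : H) ∧
    z = (p * b) ⊗ₜ[k] q - p ⊗ₜ[k] (b * q)}

/-- `P ⊗_B P`. -/
abbrev PBP := (P ⊗[k] P) ⧸ ca.relB

/-- The canonical (Galois) map `χ : P ⊗_B P → P ⊗ H`, `q ⊗ p ↦ q p₍₀₎ ⊗ p₍₁₎`. -/
def chi : ca.PBP →ₗ[k] P ⊗[k] H :=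
  qtlift k ca.relB (fun p q => tlift k (fun q0 q1 => (p * q0) ⊗ₜ[k] q1) (ca.ρ q))

/-- The extension `B ⊆ P` is Hopf–Galois when `χ` is bijective. -/
def IsGalois : Prop := Function.Bijective ca.chi

/-- The translation map `τ(h) = χ⁻¹(1 ⊗ h) ∈ P ⊗_B P`. -/
def tau (h : H) : ca.PBP := Function.invFun ca.chi ((1 : P) ⊗ₜ[k] h)

/-- Relations for the tensor product `M ⊗_B P` of a right `B`-module with `P`. -/
def ffrel (M : Type v) [AddCommGroup M] [Module (↥ca.coinv)ᵐᵒᵖ M] :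
    Submodule ℤ (M ⊗[ℤ] P) :=
  Submodule.span ℤ {z | ∃ (m : M) (b : ↥ca.coinv) (p : P),
    z = (MulOpposite.op b • m) ⊗ₜ[ℤ] p - m ⊗ₜ[ℤ] ((b : P) * p)}

/-- `M ⊗_B P` for a right `B`-module `M`. -/
abbrev MTP (M : Type v) [AddCommGroup M] [Module (↥ca.coinv)ᵐᵒᵖ M] :=
  (M ⊗[ℤ] P) ⧸ ca.ffrel M

/-- The map `M ⊗_B P → N ⊗_B P` induced by `f : M → N`. -/
def ffmap {M N : Type v} [AddCommGroup M] [Module (↥ca.coinv)ᵐᵒᵖ M]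
    [AddCommGroup N] [Module (↥ca.coinv)ᵐᵒᵖ N] (f : M → N) : ca.MTP M →ₗ[ℤ] ca.MTP N :=
  qtlift ℤ (ca.ffrel M) (fun m p => Submodule.Quotient.mk (f m ⊗ₜ[ℤ] p))

/-- `P` is faithfully flat as a left `B`-module: tensoring right `B`-modules with `P` over `B`
preserves injectivity, and detects triviality. -/
def IsFaithfullyFlat : Prop :=
  (∀ (M N : Type v) [AddCommGroup M] [Module (↥ca.coinv)ᵐᵒᵖ M]
      [AddCommGroup N] [Module (↥ca.coinv)ᵐᵒᵖ N] (f : M →+ N),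
      (∀ (b : ↥ca.coinv) (m : M), f (MulOpposite.op b • m) = MulOpposite.op b • f m) →
      Function.Injective f → Function.Injective (ca.ffmap (⇑f))) ∧
  (∀ (M : Type v) [AddCommGroup M] [Module (↥ca.coinv)ᵐᵒᵖ M],
      Subsingleton (ca.MTP M) → Subsingleton M)

/-- The diagonal coaction `β(p ⊗ q) = p₍₀₎ ⊗ q₍₀₎ ⊗ p₍₁₎q₍₁₎` on `P ⊗ P^{op}`. -/
def betaA : (P ⊗[k] Pᵐᵒᵖ) →ₗ[k] (P ⊗[k] Pᵐᵒᵖ) ⊗[k] H :=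
  tlift k (fun p oq => tlift k (fun p0 p1 => tlift k (fun q0 q1 =>
    ((p0 ⊗ₜ[k] (MulOpposite.op q0) : P ⊗[k] Pᵐᵒᵖ)) ⊗ₜ[k] (p1 * q1))
      (ca.ρ (MulOpposite.unop oq))) (ca.ρ p))

/-- Multiplication `p ⊗ q ↦ pq` on `P ⊗ P^{op}`. -/
def mulA : (P ⊗[k] Pᵐᵒᵖ) →ₗ[k] P :=
  tlift k (fun p oq => p * MulOpposite.unop oq)

/-- A bundle automorphism: a unital algebra endomorphism of `P` which is `H`-equivariant
and restricts to an automorphism of the coinvariant subalgebra. -/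
def IsBundleAut (F : P →ₐ[k] P) : Prop :=
  (∀ p : P, ca.ρ (F p) = tlift k (fun p0 p1 => F p0 ⊗ₜ[k] p1) (ca.ρ p)) ∧
  Set.BijOn F {p : P | ca.ρ p = p ⊗ₜ[k] (1 : H)} {p : P | ca.ρ p = p ⊗ₜ[k] (1 : H)}

/-- Pairing of the Ehresmann–Schauenburg coproduct `Δ(p ⊗ q) = p₍₀₎ ⊗ τ(p₍₁₎) ⊗ q` against a
`B`-balanced bilinear form `G` on `A = P ⊗ P^{op}`. -/
def esDeltaEval (ca : ComodAlg k H P) {V : Type*} [AddCommGroup V] [Module k V]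
    (G : (P ⊗[k] Pᵐᵒᵖ) → (P ⊗[k] Pᵐᵒᵖ) → V) : (P ⊗[k] Pᵐᵒᵖ) →ₗ[k] V :=
  tlift k (fun p oq => tlift k (fun p0 p1 =>
    (qtlift k ca.relB (fun u v =>
      G ((p0 ⊗ₜ[k] MulOpposite.op u : P ⊗[k] Pᵐᵒᵖ)) ((v ⊗ₜ[k] oq : P ⊗[k] Pᵐᵒᵖ))))
      (ca.tau p1)) (ca.ρ p))

/-- The right adjoint coaction applied through `f`:  `h ↦ f(h₍₂₎) ⊗ (Sh₍₁₎)h₍₃₎`. -/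
def adCoaction (f : H → P) (h : H) : P ⊗[k] H :=
  tlift k (fun h1 h23 => tlift k (fun h2 h3 =>
    f h2 ⊗ₜ[k] (HopfAlgebra.antipode (R := k) h1 * h3)) (Coalgebra.comul (R := k) h23))
    (Coalgebra.comul (R := k) h)

/-- Convolution of maps `H → P`. -/
def convH (f g : H →ₗ[k] P) : H →ₗ[k] P :=
  (tlift k (fun h1 h2 => f h1 * g h2)).comp (Coalgebra.comul (R := k) (A := H))

/-- The convolution unit `h ↦ ε(h)1`. -/
def unitH : H →ₗ[k] P :=
  (Algebra.linearMap k P).comp (Coalgebra.counit (R := k) (A := H))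

/-- `Z̃¹(H,P)`: unital `H`-colinear maps `f : H → P` (for the right adjoint coaction on `H`)
with `p₍₀₎q₍₀₎ f(p₍₁₎q₍₁₎) = p₍₀₎ f(p₍₁₎) q₍₀₎ f(q₍₁₎)`. -/
def IsZt1 (ca : ComodAlg k H P) (f : H →ₗ[k] P) : Prop :=
  f 1 = 1 ∧ (∀ h : H, ca.ρ (f h) = adCoaction (⇑f) h) ∧
  (∀ p q : P,
    tlift k (fun p0 p1 => tlift k (fun q0 q1 => p0 * q0 * f (p1 * q1)) (ca.ρ q)) (ca.ρ p) =
    tlift k (fun p0 p1 => tlift k (fun q0 q1 => p0 * f p1 * (q0 * f q1)) (ca.ρ q)) (ca.ρ p))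

/-- Evaluation `h₁ ⊗ (u ⊗ v) ↦ u f(Sh₁) v`, used for the inverse in `Z̃¹(H,P)`. -/
def evalMid (f : H → P) : H ⊗[k] (P ⊗[k] P) →ₗ[k] P :=
  tlift k (fun h1 w => (tlift k (fun u v => u * f (HopfAlgebra.antipode (R := k) h1) * v)) w)

/-- The element `h₍₁₎ ⊗ τ(h₍₂₎) ∈ H ⊗ (P ⊗_B P)`. -/
def tauLeg (ca : ComodAlg k H P) (h : H) : H ⊗[k] ca.PBP :=
  tlift k (fun h1 h2 => h1 ⊗ₜ[k] ca.tau h2) (Coalgebra.comul (R := k) h)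

/-- Convolution of maps `H ⊗ H → P`. -/
def convHH (γ δ : H → H → P) (h g : H) : P :=
  tlift k (fun h1 h2 => tlift k (fun g1 g2 => γ h1 g1 * δ h2 g2)
    (Coalgebra.comul (R := k) g)) (Coalgebra.comul (R := k) h)

/-- `Z̃²(H,P)`:  the `H`-colinear elements of `Z²_{◁,as}(H,P)`. -/
def IsZt2 (ca : ComodAlg k H P) (act : P →ₗ[k] H →ₗ[k] P) (γ : H → H → P) : Prop :=
  (∃ γ' : H →ₗ[k] H →ₗ[k] P, ∀ h g, γ' h g = γ h g) ∧
  (∀ h : H, γ h 1 = algebraMap k P (Coalgebra.counit (R := k) h) ∧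
    γ 1 h = algebraMap k P (Coalgebra.counit (R := k) h)) ∧
  (∀ h g f : H,
    tlift k (fun h1 h2 => tlift k (fun g1 g2 => tlift k (fun f1 f2 =>
      act (γ g1 f1) h1 * γ h2 (f2 * g2)) (Coalgebra.comul (R := k) f))
        (Coalgebra.comul (R := k) g)) (Coalgebra.comul (R := k) h) =
    tlift k (fun h1 h2 => tlift k (fun g1 g2 =>
      γ h1 g1 * γ (g2 * h2) f) (Coalgebra.comul (R := k) g)) (Coalgebra.comul (R := k) h)) ∧
  (∀ (h g : H) (b : P),
    tlift k (fun h1 h2 => tlift k (fun g1 g2 => γ h1 g1 * act b (g2 * h2))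
      (Coalgebra.comul (R := k) g)) (Coalgebra.comul (R := k) h) =
    tlift k (fun h1 h2 => tlift k (fun g1 g2 => act b (g1 * h1) * γ h2 g2)
      (Coalgebra.comul (R := k) g)) (Coalgebra.comul (R := k) h)) ∧
  (∀ h g : H, ca.ρ (γ h g) =
    tlift k (fun h1 h23 => tlift k (fun h2 h3 => tlift k (fun g1 g23 => tlift k (fun g2 g3 =>
      γ h2 g2 ⊗ₜ[k] (HopfAlgebra.antipode (R := k) (g1 * h1) * (g3 * h3)))
        (Coalgebra.comul (R := k) g23)) (Coalgebra.comul (R := k) g))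
      (Coalgebra.comul (R := k) h23)) (Coalgebra.comul (R := k) h)) ∧
  (∃ γi : H → H → P, (∃ γi' : H →ₗ[k] H →ₗ[k] P, ∀ h g, γi' h g = γi h g) ∧
    (∀ h g : H, convHH (k := k) γ γi h g =
      algebraMap k P (Coalgebra.counit (R := k) h * Coalgebra.counit (R := k) g)) ∧
    (∀ h g : H, convHH (k := k) γi γ h g =
      algebraMap k P (Coalgebra.counit (R := k) h * Coalgebra.counit (R := k) g)))

/-- `C̃¹(H,P)`: unital convolution-invertible `H`-colinear maps `f : H → P`, commuting
with `B` in the sense `p₍₀₎ b f(p₍₁₎) = p₍₀₎ f(p₍₁₎) b`. -/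
def IsCt1 (ca : ComodAlg k H P) (f : H →ₗ[k] P) : Prop :=
  f 1 = 1 ∧ (∀ h : H, ca.ρ (f h) = adCoaction (⇑f) h) ∧
  (∀ p b : P, ca.ρ b = b ⊗ₜ[k] (1 : H) →
    tlift k (fun p0 p1 => p0 * b * f p1) (ca.ρ p) =
      tlift k (fun p0 p1 => p0 * f p1 * b) (ca.ρ p)) ∧
  ∃ fi : H →ₗ[k] P, convH f fi = unitH ∧ convH fi f = unitH

/-- `γ^f(h,g) := (f⁻¹(g₍₁₎) ◁ h₍₁₎) f⁻¹(h₍₂₎) γ(h₍₃₎, g₍₂₎) f(g₍₃₎ h₍₄₎)`. -/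
def gamF (act : P →ₗ[k] H →ₗ[k] P) (f fi : H → P) (γ : H → H → P) (h g : H) : P :=
  tlift k (fun h1 h234 => tlift k (fun h2 h34 => tlift k (fun h3 h4 =>
    tlift k (fun g1 g23 => tlift k (fun g2 g3 =>
      act (fi g1) h1 * fi h2 * γ h3 g2 * f (g3 * h4)) (Coalgebra.comul (R := k) g23))
      (Coalgebra.comul (R := k) g))
    (Coalgebra.comul (R := k) h34)) (Coalgebra.comul (R := k) h234)) (Coalgebra.comul (R := k) h)

end ComodAlg

section ES

variable {B0 L0 : Type v} [Ring B0] [Algebra k B0] [Ring L0] [Algebra k L0]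

/-- The value of the 2-cocycle `Γ_γ(p ⊗ p', q ⊗ q') = p₍₀₎ q₍₀₎ γ(q₍₁₎, p₍₁₎) q' p'` on the
Ehresmann–Schauenburg bialgebroid, computed in `P` through an embedding `ι`. -/
def GammaOf (ca : ComodAlg k H P) (ι : L0 →ₐ[k] (P ⊗[k] Pᵐᵒᵖ)) (γ : H → H → P)
    (z w : L0) : P :=
  tlift k (fun p op' => tlift k (fun q oq' => tlift k (fun p0 p1 => tlift k (fun q0 q1 =>
    p0 * q0 * γ q1 p1 * MulOpposite.unop oq' * MulOpposite.unop op') (ca.ρ q)) (ca.ρ p))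
      (ι w)) (ι z)

end ES

end

section Lifts

open TensorProduct

variable {R : Type*} [CommRing R] {M N Q : Type*} [AddCommGroup M] [Module R M]
  [AddCommGroup N] [Module R N] [AddCommGroup Q] [Module R Q]

theorem tlift_eq_of_forall {f : M → N → Q} (F : M ⊗[R] N →ₗ[R] Q)
    (hF : ∀ x y, F (x ⊗ₜ[R] y) = f x y) : tlift R f = F := by
  have h : ∃ F : M ⊗[R] N →ₗ[R] Q, ∀ x y, F (x ⊗ₜ[R] y) = f x y := ⟨F, hF⟩
  rw [tlift, dif_pos h]
  exact TensorProduct.ext' fun x y => (h.choose_spec x y).trans (hF x y).symm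

theorem qtlift_eq_of_forall {p : Submodule R (M ⊗[R] N)} {f : M → N → Q}
    (F : ((M ⊗[R] N) ⧸ p) →ₗ[R] Q)
    (hF : ∀ x y, F (Submodule.Quotient.mk (x ⊗ₜ[R] y)) = f x y) : qtlift R p f = F := by
  have h : ∃ F : ((M ⊗[R] N) ⧸ p) →ₗ[R] Q,
      ∀ x y, F (Submodule.Quotient.mk (x ⊗ₜ[R] y)) = f x y := ⟨F, hF⟩
  rw [qtlift, dif_pos h]
  exact Submodule.linearMap_qext _ <|
    TensorProduct.ext' fun x y => (h.choose_spec x y).trans (hF x y).symm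

theorem tlift_tlift_apply {M' N' : Type*} [AddCommGroup M'] [Module R M']
    [AddCommGroup N'] [Module R N'] (B : M ⊗[R] N →ₗ[R] M' ⊗[R] N' →ₗ[R] Q)
    {f : M → N → M' → N' → Q}
    (hf : ∀ x y z w, B (x ⊗ₜ[R] y) (z ⊗ₜ[R] w) = f x y z w) (a : M ⊗[R] N) (b : M' ⊗[R] N') :
    tlift R (fun x y => tlift R (fun z w => f x y z w) b) a = B a b := by
  rw [tlift_eq_of_forall (B.flip b)]
  · rfl
  · intro x y
    rw [tlift_eq_of_forall (B (x ⊗ₜ[R] y)) (hf x y)]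
    rfl

end Lifts

namespace ComodAlg

noncomputable section Convolution

universe u v

open TensorProduct Coalgebra

variable {k : Type u} [Field k] {H P : Type v} [Ring H] [HopfAlgebra k H] [Ring P] [Algebra k P]
  {R R₂ : Type*} [Ring R] [Algebra k R] [Ring R₂] [Algebra k R₂]

/-- The convolution product of linear maps from a Hopf algebra to an algebra. -/
def conv (x y : H →ₗ[k] R) : H →ₗ[k] R :=
  LinearMap.mul' k R ∘ₗ TensorProduct.map x y ∘ₗ comul

/-- The unit for the convolution product. -/
def convUnit : H →ₗ[k] R := Algebra.linearMap k R ∘ₗ counit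

theorem convH_eq (f g : H →ₗ[k] P) : convH f g = conv f g := by
  rw [convH, tlift_eq_of_forall (LinearMap.mul' k P ∘ₗ TensorProduct.map f g)]
  · rfl
  · intro _ _
    rfl

theorem conv_assoc (x y z : H →ₗ[k] R) : conv (conv x y) z = conv x (conv y z) :=
  congrArg WithConv.ofConv
    (mul_assoc (WithConv.toConv x) (WithConv.toConv y) (WithConv.toConv z))

theorem conv_unit (x : H →ₗ[k] R) : conv x convUnit = x :=
  congrArg WithConv.ofConv (mul_one (WithConv.toConv x))

theorem unit_conv (x : H →ₗ[k] R) : conv convUnit x = x :=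
  congrArg WithConv.ofConv (one_mul (WithConv.toConv x))

theorem algHom_comp_convUnit (ψ : R →ₐ[k] R₂) :
    ψ.toLinearMap ∘ₗ (convUnit : H →ₗ[k] R) = convUnit := by
  ext h
  simp [convUnit]

theorem algHom_comp_conv (ψ : R →ₐ[k] R₂) (x y : H →ₗ[k] R) :
    ψ.toLinearMap ∘ₗ conv x y = conv (ψ.toLinearMap ∘ₗ x) (ψ.toLinearMap ∘ₗ y) := by
  have : ψ.toLinearMap ∘ₗ LinearMap.mul' k R = LinearMap.mul' k R₂ ∘ₗ
      TensorProduct.map ψ.toLinearMap ψ.toLinearMap := by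
    ext; simp
  rw [conv, ← LinearMap.comp_assoc, this, conv, TensorProduct.map_comp]
  rfl

theorem conv_antipode (ψ : H →ₐ[k] R) :
    conv ψ.toLinearMap (ψ.toLinearMap ∘ₗ HopfAlgebra.antipode k) = convUnit := by
  have h : conv LinearMap.id (HopfAlgebra.antipode k) = (convUnit : H →ₗ[k] H) :=
    HopfAlgebra.mul_antipode_lTensor_comul
  rw [← algHom_comp_convUnit ψ, ← h, algHom_comp_conv, LinearMap.comp_id]

theorem antipode_conv (ψ : H →ₐ[k] R) :
    conv (ψ.toLinearMap ∘ₗ HopfAlgebra.antipode k) ψ.toLinearMap = convUnit := by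
  have h : conv (HopfAlgebra.antipode k) LinearMap.id = (convUnit : H →ₗ[k] H) :=
    HopfAlgebra.mul_antipode_rTensor_comul
  rw [← algHom_comp_convUnit ψ, ← h, algHom_comp_conv, LinearMap.comp_id]

variable (ca : ComodAlg k H P)

theorem map_comul_coact : TensorProduct.map LinearMap.id comul ∘ₗ ca.ρ =
    (TensorProduct.assoc k P H H).toLinearMap ∘ₗ TensorProduct.map ca.ρ LinearMap.id ∘ₗ ca.ρ := by
  ext p
  have h := ca.coassoc p
  rw [tlift_eq_of_forall (TensorProduct.map LinearMap.id comul : P ⊗[k] H →ₗ[k] _),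
    tlift_eq_of_forall ((TensorProduct.assoc k P H H).toLinearMap ∘ₗ
      TensorProduct.map ca.ρ LinearMap.id)] at h
  · exact h
  · intro x y
    rw [tlift_eq_of_forall ((TensorProduct.assoc k P H H).toLinearMap ∘ₗ
      (TensorProduct.mk k (P ⊗[k] H) H).flip y)]
    · rfl
    · intro _ _
      rfl
  · intro _ _
    rfl

theorem map_counit_coact (p : P) :
    TensorProduct.rid k P (TensorProduct.map LinearMap.id counit (ca.ρ p)) = p := by
  have h := ca.counit_coact p
  rwa [tlift_eq_of_forall ((TensorProduct.rid k P).toLinearMap ∘ₗ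
    TensorProduct.map LinearMap.id counit) fun _ _ => by simp] at h

/-- The right action of the convolution algebra of `H` on linear maps out of a comodule:
`p ↦ φ(p₍₀₎) x(p₍₁₎)`. -/
def act (φ : P →ₗ[k] R) (x : H →ₗ[k] R) : P →ₗ[k] R :=
  LinearMap.mul' k R ∘ₗ TensorProduct.map φ x ∘ₗ ca.ρ

theorem act_assoc (φ : P →ₗ[k] R) (x y : H →ₗ[k] R) :
    ca.act (ca.act φ x) y = ca.act φ (conv x y) := by
  have h₁ : TensorProduct.map (ca.act φ x) y =
      TensorProduct.map (LinearMap.mul' k R ∘ₗ TensorProduct.map φ x) y ∘ₗ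
        TensorProduct.map ca.ρ LinearMap.id := by
    rw [← TensorProduct.map_comp]; rfl
  have h₂ : TensorProduct.map φ (conv x y) =
      TensorProduct.map φ (LinearMap.mul' k R ∘ₗ TensorProduct.map x y) ∘ₗ
        TensorProduct.map LinearMap.id comul := by
    rw [← TensorProduct.map_comp]; rfl
  have h₃ : LinearMap.mul' k R ∘ₗ TensorProduct.map φ (LinearMap.mul' k R ∘ₗ
      TensorProduct.map x y) ∘ₗ (TensorProduct.assoc k P H H).toLinearMap =
      LinearMap.mul' k R ∘ₗ TensorProduct.map (LinearMap.mul' k R ∘ₗ TensorProduct.map φ x) y := by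
    ext; simp [mul_assoc]
  rw [act, h₁, LinearMap.comp_assoc, ← LinearMap.comp_assoc, ← h₃]
  simp only [act, h₂, LinearMap.comp_assoc, map_comul_coact]

theorem act_unit (φ : P →ₗ[k] R) : ca.act φ convUnit = φ := by
  ext p
  have h : LinearMap.mul' k R ∘ₗ TensorProduct.map φ (convUnit : H →ₗ[k] R) =
      φ ∘ₗ (TensorProduct.rid k P).toLinearMap ∘ₗ TensorProduct.map LinearMap.id counit := by
    ext; simp [convUnit, Algebra.algebraMap_eq_smul_one]
  exact (LinearMap.congr_fun h (ca.ρ p)).trans (congrArg φ (ca.map_counit_coact p))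

theorem act_one (φ : P →ₗ[k] R) (x : H →ₗ[k] R) : ca.act φ x 1 = φ 1 * x 1 := by
  simp [act, ca.coact_one, Algebra.TensorProduct.one_def]

theorem algHom_comp_act (ψ : R →ₐ[k] R₂) (φ : P →ₗ[k] R) (x : H →ₗ[k] R) :
    ψ.toLinearMap ∘ₗ ca.act φ x = ca.act (ψ.toLinearMap ∘ₗ φ) (ψ.toLinearMap ∘ₗ x) := by
  have : ψ.toLinearMap ∘ₗ LinearMap.mul' k R = LinearMap.mul' k R₂ ∘ₗ
      TensorProduct.map ψ.toLinearMap ψ.toLinearMap := by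
    ext; simp
  rw [act, ← LinearMap.comp_assoc, this, act, TensorProduct.map_comp]
  rfl

theorem act_antipode_cancel (φ : P →ₗ[k] R) (ψ : H →ₐ[k] R) (x : H →ₗ[k] R) :
    ca.act (ca.act φ ψ.toLinearMap) (conv (ψ.toLinearMap ∘ₗ HopfAlgebra.antipode k) x) =
      ca.act φ x := by
  rw [act_assoc, ← conv_assoc, conv_antipode, unit_conv]

/-- The coaction as an algebra homomorphism. -/
def coactHom : P →ₐ[k] P ⊗[k] H := AlgHom.ofLinearMap ca.ρ ca.coact_one ca.coact_mul

@[simp] theorem coactHom_apply (p : P) : ca.coactHom p = ca.ρ p := rfl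

theorem coact_eq_act : ca.ρ = ca.act
    (Algebra.TensorProduct.includeLeft : P →ₐ[k] P ⊗[k] H).toLinearMap
    (Algebra.TensorProduct.includeRight : H →ₐ[k] P ⊗[k] H).toLinearMap := by
  have : LinearMap.mul' k (P ⊗[k] H) ∘ₗ TensorProduct.map
      (Algebra.TensorProduct.includeLeft : P →ₐ[k] P ⊗[k] H).toLinearMap
      (Algebra.TensorProduct.includeRight : H →ₐ[k] P ⊗[k] H).toLinearMap = LinearMap.id := by
    ext; simp
  rw [act, ← LinearMap.comp_assoc, this, LinearMap.id_comp]

theorem act_coinv_mul (φ : P →ₐ[k] R) (x : H →ₗ[k] R) {b : P} (hb : ca.ρ b = b ⊗ₜ[k] (1 : H))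
    (p : P) : ca.act φ.toLinearMap x (b * p) = φ b * ca.act φ.toLinearMap x p := by
  simp only [act, LinearMap.comp_apply, ca.coact_mul, hb]
  induction ca.ρ p with
  | zero => simp
  | tmul u h => simp [mul_assoc]
  | add z w hz hw => simp only [mul_add, map_add, hz, hw]

theorem act_mul_coinv (φ : P →ₐ[k] R) (x : H →ₗ[k] R) {b : P} (hb : ca.ρ b = b ⊗ₜ[k] (1 : H))
    (p : P) : ca.act φ.toLinearMap x (p * b) =
      ca.act φ.toLinearMap (LinearMap.mulLeft k (φ b) ∘ₗ x) p := by
  simp only [act, LinearMap.comp_apply, ca.coact_mul, hb]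
  induction ca.ρ p with
  | zero => simp
  | tmul u h => simp [mul_assoc]
  | add z w hz hw => simp only [add_mul, map_add, hz, hw]

theorem mulRight_act (φ : P →ₗ[k] R) (x : H →ₗ[k] R) (r : R) (p : P) :
    ca.act φ x p * r = ca.act φ (LinearMap.mulRight k r ∘ₗ x) p := by
  simp only [act, LinearMap.comp_apply]
  induction ca.ρ p with
  | zero => simp
  | tmul u h => simp [mul_assoc]
  | add z w hz hw => simp only [add_mul, map_add, hz, hw]

theorem chi_mk (c : P ⊗[k] P) : ca.chi (Submodule.Quotient.mk c) =
    LinearMap.mul' k (P ⊗[k] H) (TensorProduct.map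
      (Algebra.TensorProduct.includeLeft : P →ₐ[k] P ⊗[k] H).toLinearMap ca.ρ c) := by
  have hle : ca.relB ≤ LinearMap.ker (LinearMap.mul' k (P ⊗[k] H) ∘ₗ (TensorProduct.map
      (Algebra.TensorProduct.includeLeft : P →ₐ[k] P ⊗[k] H).toLinearMap ca.ρ)) := by
    rw [relB, Submodule.span_le]
    rintro _ ⟨p, q, b, hb, rfl⟩
    simp [ca.coact_mul, hb, ← mul_assoc]
  rw [chi, qtlift_eq_of_forall (ca.relB.liftQ _ hle)]
  · rfl
  · intro p q
    rw [tlift_eq_of_forall (LinearMap.mulLeft k (p ⊗ₜ[k] (1 : H))) (by simp)]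
    simp

theorem chi_mk_tmul (u v : P) :
    ca.chi (Submodule.Quotient.mk (u ⊗ₜ[k] v)) = (u ⊗ₜ[k] 1) * ca.ρ v := by
  simp [chi_mk]

variable {ca}

theorem map_eq_of_comp_chi (hGal : ca.IsGalois) {Q : Type*} [AddCommGroup Q] [Module k Q]
    {f g : P ⊗[k] H →ₗ[k] Q}
    (h : ∀ u v : P, f ((u ⊗ₜ[k] 1) * ca.ρ v) = g ((u ⊗ₜ[k] 1) * ca.ρ v)) : f = g := by
  have h' : f ∘ₗ ca.chi = g ∘ₗ ca.chi := by
    refine Submodule.linearMap_qext _ (TensorProduct.ext' fun u v => ?_)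
    simpa [chi_mk_tmul] using h u v
  refine LinearMap.ext fun z => ?_
  obtain ⟨y, rfl⟩ := hGal.2 z
  exact LinearMap.congr_fun h' y

theorem map_mul_act (φ : P →ₐ[k] R) (x : H →ₗ[k] R) (u v : P) :
    LinearMap.mul' k R (TensorProduct.map φ.toLinearMap x ((u ⊗ₜ[k] 1) * ca.ρ v)) =
      φ u * ca.act φ.toLinearMap x v := by
  simp only [act, LinearMap.comp_apply]
  induction ca.ρ v with
  | zero => simp
  | tmul u h => simp [mul_assoc]
  | add z w hz hw => simp only [mul_add, map_add, hz, hw]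

theorem act_injective (hGal : ca.IsGalois) (φ : P →ₐ[k] R) {x y : H →ₗ[k] R}
    (h : ca.act φ.toLinearMap x = ca.act φ.toLinearMap y) : x = y := by
  have := map_eq_of_comp_chi hGal (f := LinearMap.mul' k R ∘ₗ TensorProduct.map φ.toLinearMap x)
    (g := LinearMap.mul' k R ∘ₗ TensorProduct.map φ.toLinearMap y) fun u v => by
      simp only [LinearMap.comp_apply, map_mul_act, h]
  ext a
  simpa using LinearMap.congr_fun this (1 ⊗ₜ[k] a)

/-- The translation map as a linear map. -/
def tauHom (hGal : ca.IsGalois) : H →ₗ[k] ca.PBP :=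
  (LinearEquiv.ofBijective ca.chi hGal).symm.toLinearMap ∘ₗ TensorProduct.mk k P H 1

theorem chi_tauHom (hGal : ca.IsGalois) (h : H) : ca.chi (tauHom hGal h) = 1 ⊗ₜ[k] h :=
  (LinearEquiv.ofBijective ca.chi hGal).apply_symm_apply _

theorem tau_eq_tauHom (hGal : ca.IsGalois) (h : H) : ca.tau h = tauHom hGal h := by
  apply hGal.1
  rw [chi_tauHom, tau]
  exact Function.invFun_eq (hGal.2 _)

theorem chi_mk_mul (u : P) (c : P ⊗[k] P) :
    ca.chi (Submodule.Quotient.mk ((u ⊗ₜ[k] 1) * c)) =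
      (u ⊗ₜ[k] 1) * ca.chi (Submodule.Quotient.mk c) := by
  simp only [chi_mk]
  induction c with
  | zero => simp
  | tmul p q => simp [← mul_assoc]
  | add z w hz hw => simp only [mul_add, map_add, hz, hw]

/-- The map `x` with `φ(p₍₀₎) x(p₍₁₎) = G(p)` is given by the translation map. -/
theorem act_comp_tauHom (hGal : ca.IsGalois) (φ : P →ₐ[k] R) (G : P →ₗ[k] R)
    (N : ca.PBP →ₗ[k] R) (hN : ∀ u v, N (Submodule.Quotient.mk (u ⊗ₜ[k] v)) = φ u * G v) :
    ca.act φ.toLinearMap (N ∘ₗ tauHom hGal) = G := by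
  have hNmul : ∀ u c, N (Submodule.Quotient.mk ((u ⊗ₜ[k] 1) * c)) =
      φ u * N (Submodule.Quotient.mk c) := fun u c => by
    induction c with
    | zero => simp
    | tmul p q => simp [hN, mul_assoc]
    | add z w hz hw => simp only [mul_add, Submodule.Quotient.mk_add, map_add, hz, hw]
  let χ := LinearEquiv.ofBijective ca.chi hGal
  have hχ : ∀ y, χ y = ca.chi y := fun _ => rfl
  have key : N ∘ₗ χ.symm.toLinearMap =
      LinearMap.mul' k R ∘ₗ TensorProduct.map φ.toLinearMap (N ∘ₗ tauHom hGal) := by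
    refine TensorProduct.ext' fun p h => ?_
    obtain ⟨c, hc⟩ := Submodule.Quotient.mk_surjective _ (tauHom hGal h)
    have h₁ : χ.symm (p ⊗ₜ[k] h) = Submodule.Quotient.mk ((p ⊗ₜ[k] 1) * c) := by
      rw [LinearEquiv.symm_apply_eq, hχ, chi_mk_mul, hc, chi_tauHom]
      simp
    simp only [LinearMap.comp_apply, LinearEquiv.coe_coe, h₁, hNmul, hc]
    simp
  refine LinearMap.ext fun p => ?_
  have h₁ : χ.symm (ca.ρ p) = Submodule.Quotient.mk (1 ⊗ₜ[k] p) := by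
    rw [LinearEquiv.symm_apply_eq, hχ, chi_mk_tmul, ← Algebra.TensorProduct.one_def, one_mul]
  have h₂ := LinearMap.congr_fun key (ca.ρ p)
  simp only [LinearMap.comp_apply, LinearEquiv.coe_coe, h₁, hN] at h₂
  simpa [act] using h₂.symm

/-- For a Galois extension, every map `G : P → R` which is left linear over the coinvariants
along `φ` is of the form `p ↦ φ(p₍₀₎) x(p₍₁₎)`. -/
theorem exists_act_eq (hGal : ca.IsGalois) (φ : P →ₐ[k] R) (G : P →ₗ[k] R)
    (hG : ∀ b p : P, ca.ρ b = b ⊗ₜ[k] (1 : H) → G (b * p) = φ b * G p) :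
    ∃ x : H →ₗ[k] R, ca.act φ.toLinearMap x = G := by
  have hle : ca.relB ≤ LinearMap.ker (LinearMap.mul' k R ∘ₗ
      TensorProduct.map φ.toLinearMap G) := by
    rw [relB, Submodule.span_le]
    rintro _ ⟨p, q, b, hb, rfl⟩
    simp [hG b q hb, mul_assoc]
  exact ⟨_, act_comp_tauHom hGal φ G (ca.relB.liftQ _ hle) fun u v => by
    erw [Submodule.liftQ_apply]; simp⟩

end Convolution

end ComodAlg

namespace ComodAlg

noncomputable section Gauge

universe u v

open TensorProduct Coalgebra

variable {k : Type u} [Field k] {H P : Type v} [Ring H] [HopfAlgebra k H] [Ring P] [Algebra k P]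
  {ca : ComodAlg k H P}

variable (k H P) in
/-- The inclusion `P → P ⊗ H`. -/
abbrev inL : P →ₐ[k] P ⊗[k] H := Algebra.TensorProduct.includeLeft

variable (k H P) in
/-- The inclusion `H → P ⊗ H`. -/
abbrev inR : H →ₐ[k] P ⊗[k] H := Algebra.TensorProduct.includeRight

theorem mul'_map_inL_inR (f : P →ₗ[k] P) (z : P ⊗[k] H) :
    LinearMap.mul' k (P ⊗[k] H) (TensorProduct.map ((inL k H P).toLinearMap ∘ₗ f)
      (inR k H P).toLinearMap z) = TensorProduct.map f LinearMap.id z := by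
  induction z with
  | zero => simp
  | tmul u h => simp
  | add z w hz hw => simp only [map_add, hz, hw]

theorem adCoaction_eq_conv (f : H →ₗ[k] P) (h : H) : adCoaction (k := k) f h =
    conv ((inR k H P).toLinearMap ∘ₗ HopfAlgebra.antipode k)
      (conv ((inL k H P).toLinearMap ∘ₗ f) (inR k H P).toLinearMap) h := by
  rw [adCoaction, tlift_eq_of_forall (LinearMap.mul' k (P ⊗[k] H) ∘ₗ
    TensorProduct.map ((inR k H P).toLinearMap ∘ₗ HopfAlgebra.antipode k)
      (conv ((inL k H P).toLinearMap ∘ₗ f) (inR k H P).toLinearMap))]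
  · rfl
  · intro x y
    rw [tlift_eq_of_forall (LinearMap.mulLeft k (1 ⊗ₜ[k] HopfAlgebra.antipode k x) ∘ₗ
      LinearMap.mul' k (P ⊗[k] H) ∘ₗ TensorProduct.map ((inL k H P).toLinearMap ∘ₗ f)
        (inR k H P).toLinearMap)]
    · rfl
    · intro a b
      simp

theorem coact_eq_adCoaction_iff (f : H →ₗ[k] P) :
    (∀ h, ca.ρ (f h) = adCoaction (k := k) f h) ↔
      conv (inR k H P).toLinearMap (ca.ρ ∘ₗ f) =
        conv ((inL k H P).toLinearMap ∘ₗ f) (inR k H P).toLinearMap := by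
  simp only [adCoaction_eq_conv]
  constructor
  · intro h
    have h' : ca.ρ ∘ₗ f = _ := LinearMap.ext h
    rw [h', ← conv_assoc, conv_antipode, unit_conv]
  · intro h x
    rw [← h, ← conv_assoc, antipode_conv, unit_conv]
    rfl

/-- A gauge transformation: a vertical equivariant algebra endomorphism of `P`. -/
structure IsGauge (ca : ComodAlg k H P) (F : P →ₐ[k] P) : Prop where
  apply_coinv : ∀ b : P, ca.ρ b = b ⊗ₜ[k] (1 : H) → F b = b
  coact_apply : ∀ p, ca.ρ (F p) = TensorProduct.map F.toLinearMap LinearMap.id (ca.ρ p)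

theorem coact_comp_eq_act_iff (F : P →ₗ[k] P) :
    (∀ p, ca.ρ (F p) = TensorProduct.map F LinearMap.id (ca.ρ p)) ↔
      ca.ρ ∘ₗ F = ca.act ((inL k H P).toLinearMap ∘ₗ F) (inR k H P).toLinearMap := by
  rw [LinearMap.ext_iff]
  refine forall_congr' fun p => ?_
  simp only [act, LinearMap.comp_apply, mul'_map_inL_inR]

theorem coact_act_iff (hGal : ca.IsGalois) (f : H →ₗ[k] P) :
    (∀ p, ca.ρ (ca.act LinearMap.id f p) =
      TensorProduct.map (ca.act LinearMap.id f) LinearMap.id (ca.ρ p)) ↔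
      conv (inR k H P).toLinearMap (ca.ρ ∘ₗ f) =
        conv ((inL k H P).toLinearMap ∘ₗ f) (inR k H P).toLinearMap := by
  have h₁ : ca.ρ ∘ₗ ca.act LinearMap.id f =
      ca.act (inL k H P).toLinearMap (conv (inR k H P).toLinearMap (ca.ρ ∘ₗ f)) := by
    rw [← act_assoc, ← coact_eq_act]
    exact ca.algHom_comp_act ca.coactHom LinearMap.id f
  have h₂ : ca.act ((inL k H P).toLinearMap ∘ₗ ca.act LinearMap.id f) (inR k H P).toLinearMap =
      ca.act (inL k H P).toLinearMap
        (conv ((inL k H P).toLinearMap ∘ₗ f) (inR k H P).toLinearMap) := by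
    rw [← act_assoc]
    congr 1
    exact ca.algHom_comp_act (inL k H P) LinearMap.id f
  rw [coact_comp_eq_act_iff, h₁, h₂]
  exact ⟨act_injective hGal _, fun h => by rw [h]⟩

theorem act_mul_iff (f : H →ₗ[k] P) :
    (∀ p q : P,
      tlift k (fun p0 p1 => tlift k (fun q0 q1 => p0 * q0 * f (p1 * q1)) (ca.ρ q)) (ca.ρ p) =
      tlift k (fun p0 p1 => tlift k (fun q0 q1 => p0 * f p1 * (q0 * f q1)) (ca.ρ q)) (ca.ρ p)) ↔
    ∀ p q : P, ca.act LinearMap.id f (p * q) =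
      ca.act LinearMap.id f p * ca.act LinearMap.id f q := by
  refine forall_congr' fun p => forall_congr' fun q => ?_
  let m : P ⊗[k] H →ₗ[k] P := LinearMap.mul' k P ∘ₗ TensorProduct.map LinearMap.id f
  rw [tlift_tlift_apply ((LinearMap.mul k (P ⊗[k] H)).compr₂ m) (by intros; simp [m]),
    tlift_tlift_apply ((LinearMap.mul k P).compl₁₂ m m) (by intros; simp [m])]
  simp [act, ca.coact_mul, m]

theorem isZt1_iff (hGal : ca.IsGalois) (f : H →ₗ[k] P) : IsZt1 ca f ↔
    ∃ F : P →ₐ[k] P, IsGauge ca F ∧ F.toLinearMap = ca.act LinearMap.id f := by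
  rw [IsZt1, act_mul_iff, coact_eq_adCoaction_iff, ← coact_act_iff hGal]
  have h1 : ca.act LinearMap.id f 1 = f 1 := by simp [act_one]
  rw [← h1]
  constructor
  · rintro ⟨hone, hρ, hmul⟩
    refine ⟨AlgHom.ofLinearMap (ca.act LinearMap.id f) hone hmul, ⟨fun b hb => ?_, hρ⟩, rfl⟩
    have := ca.act_coinv_mul (AlgHom.id k P) f hb 1
    rw [mul_one] at this
    exact this.trans (by erw [hone]; simp)
  · rintro ⟨F, hF, hFf⟩
    have hFf' : ∀ p, ca.act LinearMap.id f p = F p := fun p => (LinearMap.congr_fun hFf p).symm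
    refine ⟨by rw [hFf', map_one], ?_, by simp [hFf']⟩
    rw [← hFf]
    exact hF.coact_apply

/-- The convolution element of a gauge transformation. -/
theorem IsGauge.exists_isZt1 (hGal : ca.IsGalois) {F : P →ₐ[k] P} (hF : IsGauge ca F) :
    ∃ f : H →ₗ[k] P, IsZt1 ca f ∧ F.toLinearMap = ca.act LinearMap.id f := by
  obtain ⟨f, hf⟩ := exists_act_eq hGal (AlgHom.id k P) F.toLinearMap fun b p hb => by
    simp [hF.apply_coinv b hb]
  exact ⟨f, (isZt1_iff hGal f).2 ⟨F, hF, hf.symm⟩, hf.symm⟩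

theorem IsGauge.id : IsGauge ca (AlgHom.id k P) :=
  ⟨fun _ _ => rfl, fun p => by simp⟩

theorem IsGauge.comp {F G : P →ₐ[k] P} (hF : IsGauge ca F) (hG : IsGauge ca G) :
    IsGauge ca (F.comp G) := by
  refine ⟨fun b hb => by simp [hF.apply_coinv b hb, hG.apply_coinv b hb], fun p => ?_⟩
  have : TensorProduct.map (F.comp G).toLinearMap LinearMap.id =
      TensorProduct.map F.toLinearMap LinearMap.id ∘ₗ
        TensorProduct.map G.toLinearMap (LinearMap.id : H →ₗ[k] H) := by
    rw [← TensorProduct.map_comp]; rfl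
  rw [this, LinearMap.comp_apply, ← hG.coact_apply, ← hF.coact_apply]
  rfl

theorem IsGauge.act_comp {F : P →ₐ[k] P} (hF : IsGauge ca F) (φ : P →ₗ[k] P) (g : H →ₗ[k] P) :
    ca.act φ g ∘ₗ F.toLinearMap = ca.act (φ ∘ₗ F.toLinearMap) g := by
  ext p
  simp only [act, LinearMap.comp_apply, AlgHom.toLinearMap_apply, hF.coact_apply]
  rw [← LinearMap.comp_apply (TensorProduct.map φ g), ← TensorProduct.map_comp]
  rfl

/-- Composition of gauge transformations corresponds to the opposite of convolution. -/
theorem IsGauge.toLinearMap_comp {F G : P →ₐ[k] P} {f g : H →ₗ[k] P} (hF : IsGauge ca F)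
    (hFf : F.toLinearMap = ca.act LinearMap.id f) (hGg : G.toLinearMap = ca.act LinearMap.id g) :
    (G.comp F).toLinearMap = ca.act LinearMap.id (conv f g) := by
  rw [AlgHom.comp_toLinearMap, hGg, hF.act_comp, LinearMap.id_comp, hFf, act_assoc]

theorem isZt1_conv (hGal : ca.IsGalois) {f g : H →ₗ[k] P} (hf : IsZt1 ca f) (hg : IsZt1 ca g) :
    IsZt1 ca (conv f g) := by
  obtain ⟨F, hF, hFf⟩ := (isZt1_iff hGal f).1 hf
  obtain ⟨G, hG, hGg⟩ := (isZt1_iff hGal g).1 hg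
  exact (isZt1_iff hGal _).2 ⟨G.comp F, hG.comp hF, hF.toLinearMap_comp hFf hGg⟩

theorem isZt1_unit (hGal : ca.IsGalois) : IsZt1 ca convUnit :=
  (isZt1_iff hGal _).2 ⟨AlgHom.id k P, IsGauge.id, by rw [act_unit]; rfl⟩

theorem commute_coinv (hGal : ca.IsGalois) {f : H →ₗ[k] P} (hf : IsZt1 ca f) {b : P}
    (hb : ca.ρ b = b ⊗ₜ[k] (1 : H)) (h : H) : b * f h = f h * b := by
  obtain ⟨F, hF, hFf⟩ := (isZt1_iff hGal f).1 hf
  have key : LinearMap.mulLeft k b ∘ₗ f = LinearMap.mulRight k b ∘ₗ f := by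
    refine act_injective hGal (AlgHom.id k P) (LinearMap.ext fun p => ?_)
    have h₁ := ca.act_mul_coinv (AlgHom.id k P) f hb p
    have h₂ := ca.mulRight_act (AlgHom.id k P).toLinearMap f b p
    have hFf' : ∀ p, ca.act LinearMap.id f p = F p := fun p => (LinearMap.congr_fun hFf p).symm
    refine h₁.symm.trans (Eq.trans ?_ h₂)
    erw [hFf', hFf']
    rw [map_mul, hF.apply_coinv b hb]
  exact LinearMap.congr_fun key h

/-- Every gauge transformation is invertible; its inverse is `p ↦ p₍₀₎ g(p₍₁₎)`, where `g`
satisfies `F(p₍₀₎) g(p₍₁₎) = p`. -/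
theorem isZt1_of_act_eq_id (hGal : ca.IsGalois) {F : P →ₐ[k] P} {f g : H →ₗ[k] P}
    (hF : IsGauge ca F) (hFf : F.toLinearMap = ca.act LinearMap.id f)
    (hg : ca.act F.toLinearMap g = LinearMap.id) :
    IsZt1 ca g ∧ conv f g = convUnit ∧ conv g f = convUnit := by
  have hfg : conv f g = convUnit := by
    refine act_injective hGal (AlgHom.id k P) ?_
    rw [act_unit, ← act_assoc]
    exact (congrArg (ca.act · g) hFf.symm).trans hg
  have hgf : conv g f = convUnit := by
    refine act_injective hGal F ?_
    rw [act_unit, ← act_assoc, hg, hFf]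
  refine ⟨?_, hfg, hgf⟩
  have hf := ((isZt1_iff hGal f).2 ⟨F, hF, hFf⟩).2.1
  rw [coact_eq_adCoaction_iff] at hf
  have hρ : conv (ca.ρ ∘ₗ f) (ca.ρ ∘ₗ g) = convUnit := by
    rw [← algHom_comp_convUnit ca.coactHom, ← hfg, algHom_comp_conv]; rfl
  have hL : conv ((inL k H P).toLinearMap ∘ₗ g) ((inL k H P).toLinearMap ∘ₗ f) = convUnit := by
    rw [← algHom_comp_convUnit (inL k H P), ← hgf, algHom_comp_conv]
  have hgcol : conv (inR k H P).toLinearMap (ca.ρ ∘ₗ g) =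
      conv ((inL k H P).toLinearMap ∘ₗ g) (inR k H P).toLinearMap := by
    calc _ = conv (conv (conv ((inL k H P).toLinearMap ∘ₗ g) ((inL k H P).toLinearMap ∘ₗ f))
            (inR k H P).toLinearMap) (ca.ρ ∘ₗ g) := by rw [hL, unit_conv]
      _ = conv (conv ((inL k H P).toLinearMap ∘ₗ g)
            (conv (inR k H P).toLinearMap (ca.ρ ∘ₗ f))) (ca.ρ ∘ₗ g) := by
          rw [hf]; simp only [conv_assoc]
      _ = _ := by rw [conv_assoc, conv_assoc, hρ, conv_unit]
  rw [← coact_act_iff hGal] at hgcol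
  set G := ca.act LinearMap.id g with hG
  have hGF : ∀ p, G (F p) = p := fun p => by
    have := hF.act_comp LinearMap.id g
    rw [LinearMap.id_comp, hg] at this
    exact LinearMap.congr_fun this p
  have hFG : ∀ p, F (G p) = p := fun p => by
    have h₁ : ca.act LinearMap.id f ∘ₗ G = ca.act G f := by
      ext p
      simp only [act, LinearMap.comp_apply, hgcol]
      rw [← LinearMap.comp_apply (TensorProduct.map LinearMap.id f), ← TensorProduct.map_comp]
      rfl
    rw [hG, act_assoc, hgf, act_unit, ← hFf] at h₁
    exact LinearMap.congr_fun h₁ p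
  have hinj : Function.Injective F := Function.LeftInverse.injective hGF
  refine (isZt1_iff hGal g).2 ⟨AlgHom.ofLinearMap G (hinj (by rw [hFG, map_one]))
    (fun p q => hinj (by rw [hFG, map_mul, hFG, hFG])), ⟨fun b hb => ?_, hgcol⟩, rfl⟩
  exact hinj ((hFG b).trans (hF.apply_coinv b hb).symm)

end Gauge

end ComodAlg

namespace ComodAlg

noncomputable section ExplicitInverse

universe u v

open TensorProduct Coalgebra

variable {k : Type u} [Field k] {H P : Type v} [Ring H] [HopfAlgebra k H] [Ring P] [Algebra k P]
  {ca : ComodAlg k H P}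

/-- The pairing `x ↦ [u ⊗ v] ↦ u f(x) v` for `f` commuting with the coinvariants. -/
def midPairing (f : H →ₗ[k] P)
    (hf : ∀ b, ca.ρ b = b ⊗ₜ[k] (1 : H) → ∀ h, b * f h = f h * b) : ca.PBP →ₗ[k] H →ₗ[k] P :=
  ca.relB.liftQ (TensorProduct.lift (LinearMap.mk₂ k
    (fun u v => LinearMap.mulRight k v ∘ₗ LinearMap.mulLeft k u ∘ₗ f)
    (fun _ _ _ => by ext; simp [add_mul]) (fun _ _ _ => by ext; simp)
    (fun _ _ _ => by ext; simp [mul_add]) (fun _ _ _ => by ext; simp))) <| by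
  rw [relB, Submodule.span_le]
  rintro _ ⟨p, q, b, hb, rfl⟩
  rw [SetLike.mem_coe, LinearMap.mem_ker]
  ext h
  simp only [map_sub, lift.tmul, LinearMap.mk₂_apply, LinearMap.sub_apply, LinearMap.comp_apply,
    LinearMap.mulLeft_apply, LinearMap.mulRight_apply, LinearMap.zero_apply, sub_eq_zero]
  rw [mul_assoc p b, hf b hb]
  simp only [mul_assoc]

theorem midPairing_mk (f : H →ₗ[k] P)
    (hf : ∀ b, ca.ρ b = b ⊗ₜ[k] (1 : H) → ∀ h, b * f h = f h * b) (u v : P) (h : H) :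
    midPairing f hf (Submodule.Quotient.mk (u ⊗ₜ[k] v)) h = u * f h * v := rfl

theorem act_midPairing (hGal : ca.IsGalois) (f : H →ₗ[k] P)
    (hf : ∀ b, ca.ρ b = b ⊗ₜ[k] (1 : H) → ∀ h, b * f h = f h * b) (h : H) :
    ca.act LinearMap.id ((midPairing f hf).flip h ∘ₗ tauHom hGal) = LinearMap.mulLeft k (f h) :=
  act_comp_tauHom hGal (AlgHom.id k P) _ _ fun u v => by
    simp [midPairing_mk, mul_assoc]

theorem evalMid_eq (hGal : ca.IsGalois) (f : H →ₗ[k] P)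
    (hf : ∀ b, ca.ρ b = b ⊗ₜ[k] (1 : H) → ∀ h, b * f h = f h * b) {h : H}
    {c : H ⊗[k] (P ⊗[k] P)}
    (hc : TensorProduct.map LinearMap.id (Submodule.mkQ ca.relB) c = tauLeg ca h) :
    evalMid (k := k) f c =
      TensorProduct.lift ((midPairing f hf ∘ₗ tauHom hGal).flip ∘ₗ HopfAlgebra.antipode k)
        (comul h) := by
  have h₁ : evalMid (k := k) f =
      TensorProduct.lift ((midPairing f hf).flip ∘ₗ HopfAlgebra.antipode k) ∘ₗ
        TensorProduct.map LinearMap.id (Submodule.mkQ ca.relB) := by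
    refine tlift_eq_of_forall _ fun x w => ?_
    rw [tlift_eq_of_forall (((midPairing f hf).flip (HopfAlgebra.antipode k x)) ∘ₗ
      Submodule.mkQ ca.relB)]
    · simp
    · intro u v
      rfl
  have h₂ : tauLeg ca h = TensorProduct.map LinearMap.id (tauHom hGal) (comul h) := by
    rw [tauLeg, tlift_eq_of_forall (TensorProduct.map LinearMap.id (tauHom hGal))]
    intro x y
    rw [tau_eq_tauHom hGal]
    rfl
  rw [h₁, LinearMap.comp_apply, hc, h₂, ← LinearMap.comp_apply]
  congr 1
  ext
  simp

theorem lift_midPairing_eq (hGal : ca.IsGalois) {F : P →ₐ[k] P} {f g : H →ₗ[k] P}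
    (hf : ∀ b, ca.ρ b = b ⊗ₜ[k] (1 : H) → ∀ h, b * f h = f h * b)
    (hFf : F.toLinearMap = ca.act LinearMap.id f)
    (hg : ca.act F.toLinearMap g = LinearMap.id) (h : H) :
    TensorProduct.lift ((midPairing f hf ∘ₗ tauHom hGal).flip ∘ₗ HopfAlgebra.antipode k)
      (comul h) = g h := by
  set κ := (midPairing f hf ∘ₗ tauHom hGal).flip with hκ
  let e₁ : P →ₐ[k] P ⊗[k] (H ⊗[k] H) := Algebra.TensorProduct.includeLeft
  let e₂ : H →ₐ[k] P ⊗[k] (H ⊗[k] H) :=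
    Algebra.TensorProduct.includeRight.comp Algebra.TensorProduct.includeLeft
  let e₃ : H →ₐ[k] P ⊗[k] (H ⊗[k] H) :=
    Algebra.TensorProduct.includeRight.comp Algebra.TensorProduct.includeRight
  let m : P ⊗[k] (H ⊗[k] H) →ₗ[k] P :=
    LinearMap.mul' k P ∘ₗ TensorProduct.map LinearMap.id (TensorProduct.lift κ)
  let j : P ⊗[k] H →ₐ[k] P ⊗[k] (H ⊗[k] H) :=
    Algebra.TensorProduct.map (AlgHom.id k P) Algebra.TensorProduct.includeLeft
  have hj : (j.comp ca.coactHom).toLinearMap = ca.act e₁.toLinearMap e₂.toLinearMap := by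
    have h₁ : j.toLinearMap ∘ₗ (inL k H P).toLinearMap = e₁.toLinearMap := by
      ext; simp [j, e₁, Algebra.TensorProduct.one_def]
    have h₂ : j.toLinearMap ∘ₗ (inR k H P).toLinearMap = e₂.toLinearMap := by
      ext; simp [j, e₂]
    have h₃ := ca.algHom_comp_act j (inL k H P).toLinearMap (inR k H P).toLinearMap
    rwa [h₁, h₂, ← coact_eq_act] at h₃
  have hm₁ : ∀ (a : P) (x : H) (v : P),
      m (a ⊗ₜ[k] (x ⊗ₜ[k] 1) * ca.act e₁.toLinearMap e₃.toLinearMap v) = a * f x * v := by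
    intro a x v
    have hv := LinearMap.congr_fun (act_midPairing hGal f hf x) v
    rw [LinearMap.mulLeft_apply] at hv
    rw [mul_assoc, ← hv]
    simp only [act, LinearMap.comp_apply]
    induction ca.ρ v with
    | zero => simp
    | tmul b y => simp [m, e₁, e₃, κ, mul_assoc]
    | add z w hz hw => simp only [mul_add, map_add, hz, hw]
  have hm₂ : ∀ u v : P, m (j (ca.ρ u) * ca.act e₁.toLinearMap e₃.toLinearMap v) = F u * v := by
    intro u v
    have h : ∀ z : P ⊗[k] H, m (j z * ca.act e₁.toLinearMap e₃.toLinearMap v) =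
        LinearMap.mul' k P (TensorProduct.map LinearMap.id f z) * v := fun z => by
      induction z with
      | zero => simp
      | tmul a x => exact hm₁ a x v
      | add z w hz hw => simp only [add_mul, map_add, hz, hw]
    rw [h, show F u = ca.act LinearMap.id f u from LinearMap.congr_fun hFf u]
    rfl
  have key := map_eq_of_comp_chi hGal
    (f := m ∘ₗ LinearMap.mul' k _ ∘ₗ TensorProduct.map (j.comp ca.coactHom).toLinearMap
      (conv (e₂.toLinearMap ∘ₗ HopfAlgebra.antipode k) e₃.toLinearMap))
    (g := LinearMap.mul' k P ∘ₗ TensorProduct.map F.toLinearMap g) fun u v => by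
      refine (congrArg m ((map_mul_act _ _ u v).trans ?_)).trans
        ((hm₂ u v).trans ((map_mul_act _ _ u v).trans (by rw [hg]; rfl)).symm)
      rw [hj, act_antipode_cancel]
      rfl
  have := LinearMap.congr_fun key (1 ⊗ₜ[k] h)
  simp only [LinearMap.comp_apply, map_tmul, AlgHom.toLinearMap_apply, map_one,
    LinearMap.mul'_apply, one_mul] at this
  rw [← this]
  simp only [conv, LinearMap.comp_apply]
  induction (comul h : H ⊗[k] H) with
  | zero => simp
  | tmul x y => simp [m, e₂, e₃]
  | add z w hz hw => simp only [map_add, hz, hw]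

/-- Every element of `Z̃¹(H,P)` is invertible, with inverse `h ↦ h₍₂₎⁽¹⁾ f(Sh₍₁₎) h₍₂₎⁽²⁾`. -/
theorem IsZt1.exists_inverse (hGal : ca.IsGalois) {f : H →ₗ[k] P} (hf : IsZt1 ca f) :
    ∃ g : H →ₗ[k] P, IsZt1 ca g ∧ conv f g = convUnit ∧ conv g f = convUnit ∧
      ∀ (h : H) (c : H ⊗[k] (P ⊗[k] P)),
        TensorProduct.map LinearMap.id (Submodule.mkQ ca.relB) c = tauLeg ca h →
        g h = evalMid (k := k) f c := by
  obtain ⟨F, hF, hFf⟩ := (isZt1_iff hGal f).1 hf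
  obtain ⟨g, hg⟩ := exists_act_eq hGal F LinearMap.id fun b p hb => by
    simp [hF.apply_coinv b hb]
  obtain ⟨hgZ, hfg, hgf⟩ := isZt1_of_act_eq_id hGal hF hFf hg
  have hcomm := fun b hb => commute_coinv hGal hf (b := b) hb
  exact ⟨g, hgZ, hfg, hgf, fun h c hc => by
    rw [evalMid_eq hGal f hcomm hc, lift_midPairing_eq hGal hcomm hFf hg]⟩

end ExplicitInverse

end ComodAlg

namespace ComodAlg

noncomputable section BalancedTensor

universe u v

open TensorProduct

variable {k : Type u} [Field k] {H P : Type v} [Ring H] [HopfAlgebra k H] [Ring P] [Algebra k P]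
  {ca : ComodAlg k H P} {M N L A : Type v}
  [AddCommGroup M] [Module (↥ca.coinv)ᵐᵒᵖ M] [AddCommGroup N] [Module (↥ca.coinv)ᵐᵒᵖ N]
  [AddCommGroup L] [Module (↥ca.coinv)ᵐᵒᵖ L] [AddCommGroup A] [Module (↥ca.coinv)ᵐᵒᵖ A]

variable (ca) in
/-- The class of a pure tensor in `M ⊗_B P`. -/
def MTP.mk (m : M) (p : P) : ca.MTP M := Submodule.Quotient.mk (m ⊗ₜ[ℤ] p)

theorem MTP.mk_add_left (m m' : M) (p : P) :
    MTP.mk ca (m + m') p = MTP.mk ca m p + MTP.mk ca m' p := by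
  simp [MTP.mk, TensorProduct.add_tmul]

theorem MTP.mk_add_right (m : M) (p p' : P) :
    MTP.mk ca m (p + p') = MTP.mk ca m p + MTP.mk ca m p' := by
  simp [MTP.mk, TensorProduct.tmul_add]

theorem MTP.mk_smul (b : ca.coinv) (m : M) (p : P) :
    MTP.mk ca (MulOpposite.op b • m) p = MTP.mk ca m ((b : P) * p) :=
  (Submodule.Quotient.eq _).2 (Submodule.subset_span ⟨m, b, p, rfl⟩)

variable (ca M) in
/-- `MTP.mk` as a biadditive map. -/
def MTP.mkHom : M →+ P →+ ca.MTP M :=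
  AddMonoidHom.mk' (fun m => AddMonoidHom.mk' (MTP.mk ca m) (MTP.mk_add_right m)) fun m m' =>
    AddMonoidHom.ext fun p => MTP.mk_add_left m m' p

@[simp] theorem MTP.mkHom_apply (m : M) (p : P) : MTP.mkHom ca M m p = MTP.mk ca m p := rfl

theorem MTP.induction_on {motive : ca.MTP M → Prop} (z : ca.MTP M) (zero : motive 0)
    (mk : ∀ m p, motive (MTP.mk ca m p)) (add : ∀ x y, motive x → motive y → motive (x + y)) :
    motive z := by
  obtain ⟨z, rfl⟩ := Submodule.Quotient.mk_surjective _ z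
  induction z with
  | zero => exact zero
  | tmul m p => exact mk m p
  | add x y hx hy => exact add _ _ hx hy

theorem MTP.hom_ext {Q : Type*} [AddCommGroup Q] {f g : ca.MTP M →+ Q}
    (h : ∀ m p, f (MTP.mk ca m p) = g (MTP.mk ca m p)) : f = g := by
  ext z
  induction z using MTP.induction_on with
  | zero => simp
  | mk m p => exact h m p
  | add x y hx hy => simp [hx, hy]

/-- The universal property of `M ⊗_B P`. -/
def MTP.lift {Q : Type*} [AddCommGroup Q] (f : M →+ P →+ Q)
    (hf : ∀ (b : ca.coinv) m p, f (MulOpposite.op b • m) p = f m ((b : P) * p)) :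
    ca.MTP M →+ Q :=
  ((ca.ffrel M).liftQ (TensorProduct.liftAddHom f fun r m p =>
    (DFunLike.congr_fun (map_zsmul f r m) p).trans (map_zsmul (f m) r p).symm).toIntLinearMap (by
    rw [ffrel, Submodule.span_le]
    rintro _ ⟨m, b, p, rfl⟩
    simp [hf])).toAddMonoidHom

@[simp] theorem MTP.lift_mk {Q : Type*} [AddCommGroup Q] (f : M →+ P →+ Q)
    (hf : ∀ (b : ca.coinv) m p, f (MulOpposite.op b • m) p = f m ((b : P) * p)) (m : M) (p : P) :
    MTP.lift f hf (MTP.mk ca m p) = f m p := rfl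

theorem ffmap_mk (f : M →ₗ[(↥ca.coinv)ᵐᵒᵖ] N) (m : M) (p : P) :
    ca.ffmap f (MTP.mk ca m p) = MTP.mk ca (f m) p := by
  let F : ca.MTP M →+ ca.MTP N := MTP.lift ((MTP.mkHom ca N).comp f.toAddMonoidHom) fun b m p => by
    simp [MTP.mk_smul]
  have h : ca.ffmap f = F.toIntLinearMap := by
    refine qtlift_eq_of_forall _ ?_
    intro x y
    rfl
  rw [h]
  rfl

theorem ffmap_injective (hFF : ca.IsFaithfullyFlat) (f : M →ₗ[(↥ca.coinv)ᵐᵒᵖ] N)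
    (hf : Function.Injective f) : Function.Injective (ca.ffmap f) :=
  hFF.1 M N f.toAddMonoidHom (fun _ m => f.map_smul _ m) hf

/-- Flatness preserves exactness. -/
theorem exists_ffmap_eq (hFF : ca.IsFaithfullyFlat) (i : L →ₗ[(↥ca.coinv)ᵐᵒᵖ] A)
    (d : A →ₗ[(↥ca.coinv)ᵐᵒᵖ] N) (hid : Function.Exact i d) (w : ca.MTP A)
    (hw : ca.ffmap d w = 0) : ∃ y, ca.ffmap i y = w := by
  let K : Submodule (↥ca.coinv)ᵐᵒᵖ A := LinearMap.range i
  let d' : (A ⧸ K) →ₗ[(↥ca.coinv)ᵐᵒᵖ] N := K.liftQ d fun a ha => (hid a).2 ha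
  have hd' : Function.Injective d' := by
    rw [← LinearMap.ker_eq_bot, Submodule.ker_liftQ_eq_bot']
    ext a
    exact (hid a).symm
  have hmkQ : ca.ffmap K.mkQ w = 0 := by
    apply ffmap_injective hFF d' hd'
    rw [map_zero, ← hw]
    clear hw
    induction w using MTP.induction_on with
    | zero => simp
    | mk m p => simp only [ffmap_mk]; rfl
    | add x y hx hy => simp only [map_add, hx, hy]
  let I : AddSubgroup (ca.MTP A) := (ca.ffmap i).toAddMonoidHom.range
  let q : A →+ P →+ ca.MTP A ⧸ I :=
    (AddMonoidHom.compHom (QuotientAddGroup.mk' I)).comp (MTP.mkHom ca A)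
  let g : A ⧸ K →+ P →+ ca.MTP A ⧸ I := QuotientAddGroup.lift K.toAddSubgroup q <| by
    rintro _ ⟨l, rfl⟩
    ext p
    exact (QuotientAddGroup.eq_zero_iff _).2 ⟨MTP.mk ca l p, ffmap_mk i l p⟩
  have hg : ∀ a, g (K.mkQ a) = q a := fun _ => rfl
  let s : ca.MTP (A ⧸ K) →+ ca.MTP A ⧸ I := MTP.lift g fun b m p => by
    obtain ⟨a, rfl⟩ := K.mkQ_surjective m
    rw [← map_smul, hg, hg]
    simp [q, MTP.mk_smul]
  have hs : ∀ z, s (ca.ffmap K.mkQ z) = QuotientAddGroup.mk' I z := fun z => by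
    induction z using MTP.induction_on with
    | zero => simp
    | mk m p => rw [ffmap_mk]; rfl
    | add x y hx hy => simp only [map_add, hx, hy]
  have := hs w
  rw [hmkQ, map_zero] at this
  exact (QuotientAddGroup.eq_zero_iff _).1 this.symm

end BalancedTensor

end ComodAlg

namespace ComodAlg

noncomputable section Descent

universe u v

open TensorProduct Coalgebra

variable {k : Type u} [Field k] {H P : Type v} [Ring H] [HopfAlgebra k H] [Ring P] [Algebra k P]
  {ca : ComodAlg k H P} {W : Type v} [Ring W] [Algebra k W]

/-- The right module structure of `W ⊗ P` over the coinvariants given by right multiplication on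
the second factor. -/
@[reducible] def rightModule : Module (↥ca.coinv)ᵐᵒᵖ (W ⊗[k] P) where
  smul b z := z * (1 ⊗ₜ[k] (b.unop : P))
  one_smul z := by
    change z * (1 ⊗ₜ[k] (1 : P)) = z
    rw [← Algebra.TensorProduct.one_def, mul_one]
  mul_smul b c z := by
    change z * (1 ⊗ₜ[k] ((c.unop : P) * b.unop)) =
      z * (1 ⊗ₜ[k] (c.unop : P)) * (1 ⊗ₜ[k] (b.unop : P))
    simp [mul_assoc]
  smul_zero b := zero_mul _
  smul_add b x y := add_mul _ _ _
  add_smul b c z := by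
    change z * (1 ⊗ₜ[k] ((b.unop : P) + c.unop)) = _
    rw [TensorProduct.tmul_add, mul_add]
    rfl
  zero_smul z := by
    change z * (1 ⊗ₜ[k] (0 : P)) = 0
    simp

attribute [local instance] rightModule

theorem op_smul_eq (b : ca.coinv) (z : W ⊗[k] P) :
    MulOpposite.op b • z = z * (1 ⊗ₜ[k] (b : P)) := rfl

variable (k H P W) in
/-- The map `p ⊗ h ↦ 1 ⊗ p ⊗ h`. -/
def legHom : P ⊗[k] H →ₐ[k] (W ⊗[k] P) ⊗[k] H :=
  Algebra.TensorProduct.map Algebra.TensorProduct.includeRight (AlgHom.id k H)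

@[simp] theorem legHom_tmul (p : P) (h : H) :
    legHom k H P W (p ⊗ₜ[k] h) = (1 ⊗ₜ[k] p) ⊗ₜ[k] h := rfl

variable (ca W) in
/-- The Galois map `(w ⊗ u) ⊗ v ↦ w ⊗ u v₍₀₎ ⊗ v₍₁₎` of `W ⊗ P`. -/
def chiW : ca.MTP (W ⊗[k] P) →+ (W ⊗[k] P) ⊗[k] H :=
  MTP.lift (AddMonoidHom.mk' (fun m => ((LinearMap.mulLeft k (m ⊗ₜ[k] (1 : H))) ∘ₗ
    (legHom k H P W).toLinearMap ∘ₗ ca.ρ).toAddMonoidHom) fun m m' => by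
      ext; simp [TensorProduct.add_tmul, add_mul]) fun b m p => by
    have hb : ca.ρ b = (b : P) ⊗ₜ[k] (1 : H) := b.2
    simp [op_smul_eq, ca.coact_mul, hb, ← mul_assoc]

theorem chiW_mk (m : W ⊗[k] P) (v : P) : ca.chiW W (MTP.mk ca m v) =
    (m ⊗ₜ[k] (1 : H)) * legHom k H P W (ca.ρ v) := rfl

theorem assoc_chiW_mk (w : W) (u v : P) :
    TensorProduct.assoc k W P H (ca.chiW W (MTP.mk ca (w ⊗ₜ[k] u) v)) =
      w ⊗ₜ[k] ca.chi (Submodule.Quotient.mk (u ⊗ₜ[k] v)) := by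
  rw [chiW_mk, chi_mk_tmul]
  induction ca.ρ v with
  | zero => simp
  | tmul p h => simp
  | add y z hy hz => simp only [map_add, mul_add, TensorProduct.tmul_add, hy, hz]

theorem mk_smul_tmul (r : k) (w : W) (u v : P) :
    MTP.mk ca (w ⊗ₜ[k] (r • u)) v = MTP.mk ca (w ⊗ₜ[k] u) (r • v) := by
  have := MTP.mk_smul (algebraMap k ca.coinv r) (w ⊗ₜ[k] u) v
  rw [op_smul_eq] at this
  have h : ((algebraMap k ca.coinv r : ca.coinv) : P) = algebraMap k P r := rfl
  rw [h, Algebra.TensorProduct.tmul_mul_tmul, mul_one, ← Algebra.commutes,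
    ← Algebra.smul_def, ← Algebra.smul_def] at this
  exact this

variable (ca) in
/-- The map `u ⊗ v ↦ (w ⊗ u) ⊗ v`. -/
def preDescent (w : W) : P ⊗[k] P →+ ca.MTP (W ⊗[k] P) :=
  TensorProduct.liftAddHom
    ((MTP.mkHom ca (W ⊗[k] P)).comp (TensorProduct.mk k W P w).toAddMonoidHom)
    fun r u v => mk_smul_tmul r w u v

theorem preDescent_tmul (w : W) (u v : P) :
    preDescent ca w (u ⊗ₜ[k] v) = MTP.mk ca (w ⊗ₜ[k] u) v := rfl

theorem preDescent_smul (r : k) (w : W) (z : P ⊗[k] P) :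
    preDescent ca (r • w) z = preDescent ca w (r • z) := by
  induction z with
  | zero => simp
  | tmul u v => rw [preDescent_tmul, TensorProduct.smul_tmul', preDescent_tmul,
      TensorProduct.smul_tmul]
  | add y z hy hz => simp only [smul_add, map_add, hy, hz]

theorem preDescent_add (w w' : W) (z : P ⊗[k] P) :
    preDescent ca (w + w') z = preDescent ca w z + preDescent ca w' z := by
  induction z with
  | zero => simp
  | tmul u v => simp only [preDescent_tmul, TensorProduct.add_tmul, MTP.mk_add_left]
  | add y z hy hz => simp only [map_add, hy, hz]; abel

theorem preDescent_eq_zero (w : W) {z : P ⊗[k] P} (hz : z ∈ ca.relB) :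
    preDescent ca w z = 0 := by
  suffices ∀ r : k, preDescent ca w (r • z) = 0 by simpa using this 1
  induction hz using Submodule.span_induction with
  | zero => simp
  | mem z hz =>
    obtain ⟨p, q, b, hb, rfl⟩ := hz
    intro r
    have := MTP.mk_smul (ca := ca) ⟨b, hb⟩ (w ⊗ₜ[k] (r • p)) q
    rw [op_smul_eq, Algebra.TensorProduct.tmul_mul_tmul, mul_one] at this
    rw [smul_sub, TensorProduct.smul_tmul', TensorProduct.smul_tmul', map_sub, preDescent_tmul,
      preDescent_tmul, sub_eq_zero, ← smul_mul_assoc]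
    exact this
  | add y z _ _ hy hz => intro r; rw [smul_add, map_add, hy, hz, add_zero]
  | smul a z _ hz => intro r; rw [smul_smul, hz]

variable (ca W) in
/-- The map `w ⊗ [u ⊗ v] ↦ (w ⊗ u) ⊗ v`. -/
def descent : W ⊗[k] ca.PBP →+ ca.MTP (W ⊗[k] P) :=
  TensorProduct.liftAddHom (AddMonoidHom.mk' (fun w => QuotientAddGroup.lift
    ca.relB.toAddSubgroup (preDescent ca w) fun _ hz => preDescent_eq_zero w hz) fun w w' => by
      ext z
      obtain ⟨z, rfl⟩ := Submodule.Quotient.mk_surjective _ z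
      exact preDescent_add w w' z) fun r w z => by
    obtain ⟨z, rfl⟩ := Submodule.Quotient.mk_surjective _ z
    exact preDescent_smul r w z

theorem chiW_injective (hGal : ca.IsGalois) : Function.Injective (ca.chiW W) := by
  let χ := LinearEquiv.ofBijective ca.chi hGal
  let g : (W ⊗[k] P) ⊗[k] H →+ ca.MTP (W ⊗[k] P) := (ca.descent W).comp
    (TensorProduct.map LinearMap.id χ.symm.toLinearMap ∘ₗ
      (TensorProduct.assoc k W P H).toLinearMap).toAddMonoidHom
  have hg : g.comp (ca.chiW W) = AddMonoidHom.id _ := by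
    refine MTP.hom_ext fun m v => ?_
    change g (ca.chiW W (MTP.mk ca m v)) = MTP.mk ca m v
    induction m with
    | zero => simp [MTP.mk]
    | tmul w u =>
      change ca.descent W (TensorProduct.map LinearMap.id χ.symm.toLinearMap
        (TensorProduct.assoc k W P H (ca.chiW W (MTP.mk ca (w ⊗ₜ[k] u) v)))) = _
      rw [assoc_chiW_mk, TensorProduct.map_tmul]
      erw [χ.symm_apply_apply]
      rfl
    | add y z hy hz => simp only [MTP.mk_add_left, map_add, hy, hz]
  exact Function.LeftInverse.injective (g := g) fun z => DFunLike.congr_fun hg z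

theorem chiW_surjective (hGal : ca.IsGalois) : Function.Surjective (ca.chiW W) := by
  intro t
  obtain ⟨t, rfl⟩ := (TensorProduct.assoc k W P H).symm.surjective t
  induction t with
  | zero => exact ⟨0, by simp⟩
  | tmul w z =>
    obtain ⟨c, rfl⟩ := hGal.2 z
    obtain ⟨c, rfl⟩ := Submodule.Quotient.mk_surjective _ c
    induction c with
    | zero => exact ⟨0, by simp⟩
    | tmul u v => exact ⟨MTP.mk ca (w ⊗ₜ[k] u) v, by rw [← assoc_chiW_mk]; simp⟩
    | add y z hy hz =>
      obtain ⟨a, ha⟩ := hy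
      obtain ⟨b, hb⟩ := hz
      exact ⟨a + b, by simp only [map_add, Submodule.Quotient.mk_add, TensorProduct.tmul_add,
        ha, hb]⟩
  | add y z hy hz =>
    obtain ⟨a, ha⟩ := hy
    obtain ⟨b, hb⟩ := hz
    exact ⟨a + b, by simp only [map_add, ha, hb]⟩

end Descent

end ComodAlg

namespace ComodAlg

noncomputable section CoinvariantTensor

universe u v

open TensorProduct Coalgebra

variable {k : Type u} [Field k] {H P : Type v} [Ring H] [HopfAlgebra k H] [Ring P] [Algebra k P]
  {ca : ComodAlg k H P} {R : Type*} [Ring R] [Algebra k R]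

attribute [local instance] rightModule

/-- The map `p ⊗ q ↦ φ(p) ψ(q)`. -/
def pairing (φ ψ : P →ₐ[k] R) : P ⊗[k] P →ₗ[k] R :=
  LinearMap.mul' k R ∘ₗ TensorProduct.map φ.toLinearMap ψ.toLinearMap

@[simp] theorem pairing_tmul (φ ψ : P →ₐ[k] R) (p q : P) :
    pairing φ ψ (p ⊗ₜ[k] q) = φ p * ψ q := rfl

theorem pairing_mul_one_tmul (φ ψ : P →ₐ[k] R) (z : P ⊗[k] P) (q : P) :
    pairing φ ψ (z * (1 ⊗ₜ[k] q)) = pairing φ ψ z * ψ q := by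
  induction z with
  | zero => simp
  | tmul u v => simp [mul_assoc]
  | add y z hy hz => simp only [add_mul, map_add, hy, hz]

/-- The map `p ⊗ q ⊗ h ↦ φ(p) ψ(q) x(h)`. -/
def pairing₃ (φ ψ : P →ₐ[k] R) (x : H →ₗ[k] R) : (P ⊗[k] P) ⊗[k] H →ₗ[k] R :=
  LinearMap.mul' k R ∘ₗ TensorProduct.map (pairing φ ψ) x

theorem pairing₃_chiW (φ ψ : P →ₐ[k] R) (x : H →ₗ[k] R) (a : P ⊗[k] P) (v : P) :
    pairing₃ φ ψ x (ca.chiW P (MTP.mk ca a v)) =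
      pairing φ ψ a * ca.act ψ.toLinearMap x v := by
  rw [chiW_mk, act]
  simp only [LinearMap.comp_apply]
  induction a with
  | zero => simp
  | add y z hy hz => simp only [TensorProduct.add_tmul, add_mul, map_add, hy, hz]
  | tmul p q =>
    induction ca.ρ v with
    | zero => simp
    | tmul u h => simp [pairing₃, mul_assoc]
    | add y z hy hz => simp only [mul_add, map_add, hy, hz]

variable (k H P) in
/-- The map `p ⊗ h ↦ p ⊗ 1 ⊗ h`. -/
def firstHom : P ⊗[k] H →ₐ[k] (P ⊗[k] P) ⊗[k] H :=
  Algebra.TensorProduct.map Algebra.TensorProduct.includeLeft (AlgHom.id k H)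

@[simp] theorem firstHom_tmul (p : P) (h : H) :
    firstHom k H P (p ⊗ₜ[k] h) = (p ⊗ₜ[k] 1) ⊗ₜ[k] h := rfl

theorem pairing₃_firstHom (φ ψ : P →ₐ[k] R) (x : H →ₗ[k] R) (p : P) :
    pairing₃ φ ψ x (firstHom k H P (ca.ρ p)) = ca.act φ.toLinearMap x p := by
  rw [act]
  simp only [LinearMap.comp_apply]
  induction ca.ρ p with
  | zero => simp
  | tmul u h => simp [pairing₃]
  | add y z hy hz => simp only [map_add, hy, hz]

variable (ca) in
/-- The diagonal coaction `p ⊗ q ↦ p₍₀₎ ⊗ q₍₀₎ ⊗ p₍₁₎q₍₁₎`. -/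
def diagCoact : P ⊗[k] P →ₗ[k] (P ⊗[k] P) ⊗[k] H :=
  pairing ((firstHom k H P).comp ca.coactHom) ((legHom k H P P).comp ca.coactHom)

theorem diagCoact_tmul (p q : P) : ca.diagCoact (p ⊗ₜ[k] q) =
    firstHom k H P (ca.ρ p) * legHom k H P P (ca.ρ q) := rfl

theorem diagCoact_mul (z : P ⊗[k] P) (q : P) :
    ca.diagCoact (z * (1 ⊗ₜ[k] q)) = ca.diagCoact z * legHom k H P P (ca.ρ q) :=
  pairing_mul_one_tmul _ _ _ _

theorem map_counit_diagCoact (z : P ⊗[k] P) :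
    TensorProduct.rid k _ (TensorProduct.map LinearMap.id counit (ca.diagCoact z)) = z := by
  let κ : (P ⊗[k] P) ⊗[k] H →ₐ[k] P ⊗[k] P :=
    (Algebra.TensorProduct.rid k k (P ⊗[k] P)).toAlgHom.comp
      (Algebra.TensorProduct.map (AlgHom.id k _) (Bialgebra.counitAlgHom k H))
  have h₁ : ∀ w : P ⊗[k] H, κ (firstHom k H P w) =
      (TensorProduct.rid k P (TensorProduct.map LinearMap.id counit w)) ⊗ₜ[k] 1 := fun w => by
    induction w with
    | zero => simp
    | tmul u h => simp [κ, TensorProduct.smul_tmul']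
    | add y z hy hz => simp only [map_add, TensorProduct.add_tmul, hy, hz]
  have h₂ : ∀ w : P ⊗[k] H, κ (legHom k H P P w) =
      1 ⊗ₜ[k] (TensorProduct.rid k P (TensorProduct.map LinearMap.id counit w)) := fun w => by
    induction w with
    | zero => simp
    | tmul u h => simp [κ]
    | add y z hy hz => simp only [map_add, TensorProduct.tmul_add, hy, hz]
  change κ (ca.diagCoact z) = z
  induction z with
  | zero => simp
  | tmul p q => simp [diagCoact_tmul, h₁, h₂, map_counit_coact]
  | add y z hy hz => simp only [map_add, hy, hz]

theorem diagCoact_injective : Function.Injective ca.diagCoact := fun y z h => by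
  rw [← map_counit_diagCoact (ca := ca) y, h, map_counit_diagCoact]

variable (k H P) in
/-- The inclusion `p ⊗ h ↦ p ⊗ h ⊗ 1`. -/
abbrev legLeft : P ⊗[k] H →ₐ[k] (P ⊗[k] H) ⊗[k] P := Algebra.TensorProduct.includeLeft

variable (k H P) in
/-- The inclusion `p ⊗ h ↦ 1 ⊗ h ⊗ p`. -/
def legRight : P ⊗[k] H →ₐ[k] (P ⊗[k] H) ⊗[k] P :=
  (Algebra.TensorProduct.map Algebra.TensorProduct.includeRight (AlgHom.id k P)).comp
    (Algebra.TensorProduct.comm k P H).toAlgHom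

@[simp] theorem legRight_tmul (p : P) (h : H) :
    legRight k H P (p ⊗ₜ[k] h) = (1 ⊗ₜ[k] h) ⊗ₜ[k] p := rfl

theorem pairing_leg (z : P ⊗[k] P) :
    pairing ((legLeft k H P).comp ca.coactHom) ((legRight k H P).comp ca.coactHom) z =
      TensorProduct.rightComm k P P H (ca.diagCoact z) := by
  induction z with
  | zero => simp
  | add y z hy hz => simp only [map_add, hy, hz]
  | tmul p q =>
    simp only [pairing_tmul, diagCoact_tmul, AlgHom.comp_apply, coactHom_apply]
    induction ca.ρ p with
    | zero => simp
    | add y z hy hz => simp only [map_add, add_mul, hy, hz]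
    | tmul u h =>
      induction ca.ρ q with
      | zero => simp
      | add y z hy hz => simp only [map_add, mul_add, hy, hz]
      | tmul v g => simp

theorem pairing_inL (z : P ⊗[k] P) :
    pairing ((legLeft k H P).comp (inL k H P)) ((legRight k H P).comp (inL k H P)) z =
      TensorProduct.rightComm k P P H (z ⊗ₜ[k] 1) := by
  induction z with
  | zero => simp
  | add y z hy hz => simp only [map_add, TensorProduct.add_tmul, hy, hz]
  | tmul p q => simp

variable (ca) in
/-- The defect of coinvariance `p ⊗ q ↦ p₍₀₎ ⊗ p₍₁₎q₍₁₎ ⊗ q₍₀₎ - p ⊗ 1 ⊗ q`. -/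
def defect : P ⊗[k] P →ₗ[(↥ca.coinv)ᵐᵒᵖ] (P ⊗[k] H) ⊗[k] P where
  toFun z := pairing ((legLeft k H P).comp ca.coactHom) ((legRight k H P).comp ca.coactHom) z -
    pairing ((legLeft k H P).comp (inL k H P)) ((legRight k H P).comp (inL k H P)) z
  map_add' y z := by simp only [map_add]; abel
  map_smul' b z := by
    have hb : ca.ρ (b.unop : P) = (b.unop : P) ⊗ₜ[k] (1 : H) := b.unop.2
    obtain ⟨b, rfl⟩ := MulOpposite.op_surjective b
    simp only [op_smul_eq, pairing_mul_one_tmul, RingHom.id_apply, sub_mul, MulOpposite.unop_op,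
      AlgHom.comp_apply, coactHom_apply] at hb ⊢
    rw [hb]
    simp [Algebra.TensorProduct.one_def]

theorem defect_eq_zero_iff (z : P ⊗[k] P) :
    ca.defect z = 0 ↔ ca.diagCoact z = z ⊗ₜ[k] 1 := by
  rw [← (TensorProduct.rightComm k P P H).injective.eq_iff, ← pairing_leg, ← pairing_inL]
  exact sub_eq_zero

theorem act_incl_coact {N : Type*} [Ring N] [Algebra k N] (E : P ⊗[k] H →ₐ[k] N)
    (i : N →ₐ[k] R) (x : H →ₗ[k] R) :
    ca.act (i.comp (E.comp ca.coactHom)).toLinearMap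
      (conv (((i.comp E).comp (inR k H P)).toLinearMap ∘ₗ HopfAlgebra.antipode k) x) =
      ca.act (i.comp (E.comp (inL k H P))).toLinearMap x := by
  rw [← act_antipode_cancel ca (i.comp (E.comp (inL k H P))).toLinearMap
    ((i.comp E).comp (inR k H P)) x]
  congr 1
  have := ca.algHom_comp_act (i.comp E) (inL k H P).toLinearMap (inR k H P).toLinearMap
  rw [← coact_eq_act] at this
  exact this

theorem act_legRight (v : P) :
    ca.act ((Algebra.TensorProduct.includeLeft : _ →ₐ[k] ((P ⊗[k] H) ⊗[k] P) ⊗[k] H).comp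
      ((legRight k H P).comp (inL k H P))).toLinearMap
      (Algebra.TensorProduct.includeRight : H →ₐ[k] _).toLinearMap v =
      legHom k H P (P ⊗[k] H) (ca.ρ v) := by
  rw [act]
  simp only [LinearMap.comp_apply]
  induction ca.ρ v with
  | zero => simp
  | tmul u h => simp [← Algebra.TensorProduct.one_def]
  | add y z hy hz => simp only [map_add, hy, hz]

/-- The image of `p ⊗ 1` under the Galois map is annihilated by the defect. -/
theorem ffmap_defect_eq_zero (hGal : ca.IsGalois) {w : ca.MTP (P ⊗[k] P)} {p : P}
    (hw : ca.chiW P w = firstHom k H P (ca.ρ p)) : ca.ffmap ca.defect w = 0 := by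
  let i : (P ⊗[k] H) ⊗[k] P →ₐ[k] ((P ⊗[k] H) ⊗[k] P) ⊗[k] H := Algebra.TensorProduct.includeLeft
  let e := (Algebra.TensorProduct.includeRight :
    H →ₐ[k] ((P ⊗[k] H) ⊗[k] P) ⊗[k] H).toLinearMap
  let x := conv (R := ((P ⊗[k] H) ⊗[k] P) ⊗[k] H)
    (((i.comp (legLeft k H P)).comp (inR k H P)).toLinearMap ∘ₗ HopfAlgebra.antipode k) e
  have hleg : (legLeft k H P).comp (inR k H P) = (legRight k H P).comp (inR k H P) := by
    ext h; simp
  let D := pairing₃ (R := ((P ⊗[k] H) ⊗[k] P) ⊗[k] H) (i.comp ((legLeft k H P).comp ca.coactHom))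
    (i.comp ((legRight k H P).comp ca.coactHom)) x
  let D₀ := pairing₃ (R := ((P ⊗[k] H) ⊗[k] P) ⊗[k] H) (i.comp ((legLeft k H P).comp (inL k H P)))
    (i.comp ((legRight k H P).comp (inL k H P))) e
  have hx : x = conv (((i.comp (legRight k H P)).comp (inR k H P)).toLinearMap ∘ₗ
      HopfAlgebra.antipode k) e := by
    have h : (i.comp (legLeft k H P)).comp (inR k H P) =
        (i.comp (legRight k H P)).comp (inR k H P) := by
      rw [AlgHom.comp_assoc, hleg, AlgHom.comp_assoc]
    rw [← h]
  have hi : ∀ (φ ψ : P →ₐ[k] (P ⊗[k] H) ⊗[k] P) (a : P ⊗[k] P),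
      pairing (i.comp φ) (i.comp ψ) a = pairing φ ψ a ⊗ₜ[k] (1 : H) := fun φ ψ a => by
    induction a with
    | zero => simp
    | tmul u v => simp [i]
    | add y z hy hz => simp only [map_add, TensorProduct.add_tmul, hy, hz]
  have key : ∀ w, ca.chiW (P ⊗[k] H) (ca.ffmap ca.defect w) =
      D (ca.chiW P w) - D₀ (ca.chiW P w) := fun w => by
    induction w using MTP.induction_on with
    | zero => simp
    | add y z hy hz => simp only [map_add, hy, hz]; abel
    | mk a v =>
      rw [ffmap_mk, pairing₃_chiW, pairing₃_chiW, hx, act_incl_coact, act_legRight, chiW_mk,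
        hi, hi]
      exact (congrArg (· * legHom k H P (P ⊗[k] H) (ca.ρ v))
        (TensorProduct.sub_tmul _ _ (1 : H))).trans (sub_mul _ _ _)
  apply chiW_injective hGal
  rw [key, hw, pairing₃_firstHom, pairing₃_firstHom, act_incl_coact, sub_self, map_zero]

variable {L : Type v} [AddCommGroup L] [Module (↥ca.coinv)ᵐᵒᵖ L]

/-- The map `L ⊗_B P → P ⊗ P`, `X ⊗ v ↦ j(X) (1 ⊗ v)`. -/
def coinvMul (j : L →ₗ[(↥ca.coinv)ᵐᵒᵖ] P ⊗[k] P) : ca.MTP L →+ P ⊗[k] P :=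
  MTP.lift (AddMonoidHom.mk' (fun X => AddMonoidHom.mk' (fun v => j X * (1 ⊗ₜ[k] v))
    fun v v' => by rw [TensorProduct.tmul_add, mul_add]) fun X X' => by
      ext v; simp [add_mul]) fun b X v => by
    simp [op_smul_eq, mul_assoc]

@[simp] theorem coinvMul_mk (j : L →ₗ[(↥ca.coinv)ᵐᵒᵖ] P ⊗[k] P) (X : L) (v : P) :
    coinvMul j (MTP.mk ca X v) = j X * (1 ⊗ₜ[k] v) := rfl

theorem diagCoact_coinvMul (j : L →ₗ[(↥ca.coinv)ᵐᵒᵖ] P ⊗[k] P)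
    (hj : ∀ X, ca.diagCoact (j X) = j X ⊗ₜ[k] 1) (w : ca.MTP L) :
    ca.diagCoact (coinvMul j w) = ca.chiW P (ca.ffmap j w) := by
  induction w using MTP.induction_on with
  | zero => simp
  | mk X v => rw [coinvMul_mk, diagCoact_mul, ffmap_mk, chiW_mk, hj]
  | add y z hy hz => simp only [map_add, hy, hz]

/-- Faithfully flat descent for the diagonal coaction on `P ⊗ P`. -/
theorem coinvMul_bijective (hGal : ca.IsGalois) (hFF : ca.IsFaithfullyFlat)
    (j : L →ₗ[(↥ca.coinv)ᵐᵒᵖ] P ⊗[k] P) (hj : Function.Injective j)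
    (hrange : ∀ z, z ∈ Set.range j ↔ ca.diagCoact z = z ⊗ₜ[k] 1) :
    Function.Bijective (coinvMul j) := by
  have hδ : ∀ w, ca.diagCoact (coinvMul j w) = ca.chiW P (ca.ffmap j w) :=
    diagCoact_coinvMul j fun X => (hrange _).1 ⟨X, rfl⟩
  constructor
  · intro y z h
    apply ffmap_injective hFF j hj
    apply chiW_injective hGal
    rw [← hδ, ← hδ, h]
  · have hleft : ∀ p : P, ∃ y, coinvMul j y = p ⊗ₜ[k] 1 := fun p => by
      obtain ⟨w, hw⟩ := chiW_surjective hGal (firstHom k H P (ca.ρ p))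
      obtain ⟨y, rfl⟩ := exists_ffmap_eq hFF j ca.defect
        (fun z => (defect_eq_zero_iff z).trans (hrange z).symm) w (ffmap_defect_eq_zero hGal hw)
      refine ⟨y, diagCoact_injective (ca := ca) ?_⟩
      rw [hδ, hw, diagCoact_tmul, ca.coact_one, map_one, mul_one]
    have hmul : ∀ (y : ca.MTP L) (q : P), ∃ y', coinvMul j y' = coinvMul j y * (1 ⊗ₜ[k] q) :=
      fun y q => by
        induction y using MTP.induction_on with
        | zero => exact ⟨0, by simp⟩
        | mk X v => exact ⟨MTP.mk ca X (v * q), by simp [mul_assoc]⟩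
        | add y z hy hz =>
          obtain ⟨a, ha⟩ := hy
          obtain ⟨b, hb⟩ := hz
          exact ⟨a + b, by simp only [map_add, add_mul, ha, hb]⟩
    intro z
    induction z with
    | zero => exact ⟨0, map_zero _⟩
    | tmul p q =>
      obtain ⟨y, hy⟩ := hleft p
      obtain ⟨y', hy'⟩ := hmul y q
      exact ⟨y', by rw [hy', hy]; simp⟩
    | add y z hy hz =>
      obtain ⟨a, ha⟩ := hy
      obtain ⟨b, hb⟩ := hz
      exact ⟨a + b, by rw [map_add, ha, hb]⟩

end CoinvariantTensor

end ComodAlg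

namespace ComodAlg

noncomputable section EhresmannSchauenburg

universe u v

open TensorProduct Coalgebra

variable {k : Type u} [Field k] {H P : Type v} [Ring H] [HopfAlgebra k H] [Ring P] [Algebra k P]
  {ca : ComodAlg k H P} {B0 L0 : Type v} [Ring B0] [Algebra k B0] [Ring L0] [Algebra k L0]

variable (k P) in
/-- The identification of `P ⊗ Pᵒᵖ` with `P ⊗ P` as vector spaces. -/
def unopTensor : P ⊗[k] Pᵐᵒᵖ ≃ₗ[k] P ⊗[k] P :=
  TensorProduct.congr (LinearEquiv.refl k P) (MulOpposite.opLinearEquiv k).symm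

@[simp] theorem unopTensor_tmul (p : P) (q : Pᵐᵒᵖ) :
    unopTensor k P (p ⊗ₜ[k] q) = p ⊗ₜ[k] q.unop := rfl

theorem unopTensor_op_mul (q : P) (x : P ⊗[k] Pᵐᵒᵖ) :
    unopTensor k P ((1 ⊗ₜ[k] MulOpposite.op q) * x) = unopTensor k P x * (1 ⊗ₜ[k] q) := by
  induction x with
  | zero => simp
  | tmul u v => simp
  | add y z hy hz => simp only [mul_add, add_mul, map_add, hy, hz]

theorem unopTensor_mul_op (q : P) (x : P ⊗[k] Pᵐᵒᵖ) :
    unopTensor k P (x * (1 ⊗ₜ[k] MulOpposite.op q)) = (1 ⊗ₜ[k] q) * unopTensor k P x := by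
  induction x with
  | zero => simp
  | tmul u v => simp
  | add y z hy hz => simp only [mul_add, add_mul, map_add, hy, hz]

theorem unopTensor_tmul_one_mul (p : P) (x : P ⊗[k] Pᵐᵒᵖ) :
    unopTensor k P ((p ⊗ₜ[k] 1) * x) = (p ⊗ₜ[k] 1) * unopTensor k P x := by
  induction x with
  | zero => simp
  | tmul u v => simp
  | add y z hy hz => simp only [mul_add, map_add, hy, hz]

theorem map_unopTensor_betaA (x : P ⊗[k] Pᵐᵒᵖ) :
    TensorProduct.map (unopTensor k P).toLinearMap LinearMap.id (ca.betaA x) =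
      ca.diagCoact (unopTensor k P x) := by
  let E : (P ⊗[k] P) ⊗[k] H ≃ₗ[k] (P ⊗[k] Pᵐᵒᵖ) ⊗[k] H :=
    TensorProduct.congr (unopTensor k P).symm (LinearEquiv.refl k H)
  have hE : ∀ y, TensorProduct.map (unopTensor k P).toLinearMap LinearMap.id (E y) = y :=
    E.symm_apply_apply
  have h : ca.betaA = E.toLinearMap ∘ₗ ca.diagCoact ∘ₗ (unopTensor k P).toLinearMap := by
    refine tlift_eq_of_forall _ ?_
    intro p q
    have := tlift_tlift_apply (((LinearMap.mul k ((P ⊗[k] P) ⊗[k] H)).compl₁₂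
      (firstHom k H P).toLinearMap (legHom k H P P).toLinearMap).compr₂ E.toLinearMap)
      (f := fun p0 p1 q0 q1 => (p0 ⊗ₜ[k] MulOpposite.op q0 : P ⊗[k] Pᵐᵒᵖ) ⊗ₜ[k] (p1 * q1))
      (by intro x y z w; simp [E, unopTensor]) (ca.ρ p) (ca.ρ q.unop)
    exact this.symm
  rw [h]
  exact hE _

theorem betaA_eq_iff (x : P ⊗[k] Pᵐᵒᵖ) : ca.betaA x = x ⊗ₜ[k] 1 ↔
    ca.diagCoact (unopTensor k P x) = unopTensor k P x ⊗ₜ[k] 1 := by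
  let E : (P ⊗[k] Pᵐᵒᵖ) ⊗[k] H ≃ₗ[k] (P ⊗[k] P) ⊗[k] H :=
    TensorProduct.congr (unopTensor k P) (LinearEquiv.refl k H)
  rw [← map_unopTensor_betaA, ← E.injective.eq_iff]
  rfl

/-- Realisation of source and target data inside `P ⊗ Pᵒᵖ` as the Ehresmann–Schauenburg algebra
of `P`. -/
structure IsESEmbedding (ca : ComodAlg k H P) (ιB : B0 →ₐ[k] P) (ι : L0 →ₐ[k] P ⊗[k] Pᵐᵒᵖ)
    (st : BgdST k B0 L0) : Prop where
  injective_base : Function.Injective ιB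
  range_base : Set.range ιB = {p : P | ca.ρ p = p ⊗ₜ[k] (1 : H)}
  injective : Function.Injective ι
  range : Set.range ι = {z : P ⊗[k] Pᵐᵒᵖ | ca.betaA z = z ⊗ₜ[k] (1 : H)}
  map_s : ∀ b : B0, ι (st.s b) = (ιB b) ⊗ₜ[k] MulOpposite.op (1 : P)
  map_t : ∀ b : B0, ι (st.t b) = (1 : P) ⊗ₜ[k] MulOpposite.op (ιB b)

variable {ιB : B0 →ₐ[k] P} {ι : L0 →ₐ[k] P ⊗[k] Pᵐᵒᵖ} {st : BgdST k B0 L0}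

namespace IsESEmbedding

theorem coact_base (hES : IsESEmbedding ca ιB ι st) (b : B0) : ca.ρ (ιB b) = ιB b ⊗ₜ[k] 1 := by
  have : ιB b ∈ Set.range ιB := ⟨b, rfl⟩
  rwa [hES.range_base] at this

theorem exists_base (hES : IsESEmbedding ca ιB ι st) {p : P} (hp : ca.ρ p = p ⊗ₜ[k] 1) :
    ∃ b, ιB b = p := by
  change p ∈ Set.range ιB
  rwa [hES.range_base]

theorem diagCoact_apply (hES : IsESEmbedding ca ιB ι st) (X : L0) :
    ca.diagCoact (unopTensor k P (ι X)) = unopTensor k P (ι X) ⊗ₜ[k] 1 := by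
  have : ι X ∈ Set.range ι := ⟨X, rfl⟩
  rw [hES.range] at this
  exact (betaA_eq_iff _).1 this

theorem apply_t_mul (hES : IsESEmbedding ca ιB ι st) (b : B0) (X : L0) :
    unopTensor k P (ι (st.t b * X)) = unopTensor k P (ι X) * (1 ⊗ₜ[k] ιB b) := by
  rw [map_mul, hES.map_t, unopTensor_op_mul]

theorem apply_mul_t (hES : IsESEmbedding ca ιB ι st) (b : B0) (X : L0) :
    unopTensor k P (ι (X * st.t b)) = (1 ⊗ₜ[k] ιB b) * unopTensor k P (ι X) := by
  rw [map_mul, hES.map_t, unopTensor_mul_op]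

theorem apply_s_mul (hES : IsESEmbedding ca ιB ι st) (b : B0) (X : L0) :
    unopTensor k P (ι (st.s b * X)) = (ιB b ⊗ₜ[k] 1) * unopTensor k P (ι X) := by
  rw [map_mul, hES.map_s, MulOpposite.op_one, unopTensor_tmul_one_mul]

/-- Descent: `P ⊗ P` is generated as a right `P`-module by the Ehresmann–Schauenburg algebra, and
right linear maps out of it may be prescribed there. -/
theorem descent (hES : IsESEmbedding ca ιB ι st) (hGal : ca.IsGalois) (hFF : ca.IsFaithfullyFlat) :
    (∀ motive : P ⊗[k] P → Prop, motive 0 →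
      (∀ X v, motive (unopTensor k P (ι X) * (1 ⊗ₜ[k] v))) →
      (∀ y z, motive y → motive z → motive (y + z)) → ∀ z, motive z) ∧
    ∀ σ : L0 →ₗ[k] B0, (∀ b X, σ (st.t b * X) = σ X * b) →
      ∃ T : P ⊗[k] P →+ P, ∀ X v, T (unopTensor k P (ι X) * (1 ⊗ₜ[k] v)) = ιB (σ X) * v := by
  choose β hβ using fun b : ca.coinv => hES.exists_base b.2
  have hβ_one : β 1 = 1 := hES.injective_base ((hβ 1).trans (map_one ιB).symm)
  have hβ_mul : ∀ a b, β (a * b) = β a * β b := fun a b => hES.injective_base <| by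
    rw [hβ, map_mul, hβ, hβ]; rfl
  have hβ_add : ∀ a b, β (a + b) = β a + β b := fun a b => hES.injective_base <| by
    rw [hβ, map_add, hβ, hβ]; rfl
  have hβ_zero : β 0 = 0 := hES.injective_base ((hβ 0).trans (map_zero ιB).symm)
  let _ : Module (↥ca.coinv)ᵐᵒᵖ L0 :=
    { smul := fun b X => st.t (β b.unop) * X
      one_smul := fun X => by
        change st.t (β 1) * X = X
        rw [hβ_one, st.t_one, one_mul]
      mul_smul := fun b c X => by
        change st.t (β (c.unop * b.unop)) * X = st.t (β b.unop) * (st.t (β c.unop) * X)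
        rw [hβ_mul, st.t_mul, mul_assoc]
      smul_zero := fun b => mul_zero _
      smul_add := fun b X Y => mul_add _ _ _
      add_smul := fun b c X => by
        change st.t (β (b.unop + c.unop)) * X = _
        rw [hβ_add, map_add, add_mul]
        rfl
      zero_smul := fun X => by
        change st.t (β 0) * X = 0
        rw [hβ_zero, map_zero, zero_mul] }
  let _ : Module (↥ca.coinv)ᵐᵒᵖ (P ⊗[k] P) := rightModule
  have hsmul : ∀ (b : ca.coinv) (X : L0), MulOpposite.op b • X = st.t (β b) * X := fun _ _ => rfl
  let j : L0 →ₗ[(↥ca.coinv)ᵐᵒᵖ] P ⊗[k] P :=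
    { toFun := fun X => unopTensor k P (ι X)
      map_add' := fun X Y => by rw [map_add, map_add]
      map_smul' := fun b X => by
        obtain ⟨b, rfl⟩ := MulOpposite.op_surjective b
        rw [hsmul, hES.apply_t_mul, hβ]
        rfl }
  have hj : Function.Injective j := (unopTensor k P).injective.comp hES.injective
  have hrange : ∀ z, z ∈ Set.range j ↔ ca.diagCoact z = z ⊗ₜ[k] 1 := fun z => by
    constructor
    · rintro ⟨X, rfl⟩
      exact hES.diagCoact_apply X
    · intro hz
      obtain ⟨x, rfl⟩ := (unopTensor k P).surjective z
      have : x ∈ Set.range ι := by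
        rw [hES.range]
        exact (betaA_eq_iff _).2 hz
      obtain ⟨X, rfl⟩ := this
      exact ⟨X, rfl⟩
  have hbij := coinvMul_bijective hGal hFF j hj hrange
  constructor
  · intro motive zero gen add z
    obtain ⟨w, rfl⟩ := hbij.2 z
    induction w using MTP.induction_on with
    | zero => rwa [map_zero]
    | mk X v => exact gen X v
    | add y z hy hz => rw [map_add]; exact add _ _ hy hz
  · intro σ hσ
    let T₀ : ca.MTP L0 →+ P := MTP.lift ((AddMonoidHom.mul (R := P)).comp
      (ιB.toLinearMap ∘ₗ σ).toAddMonoidHom) fun b X v => by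
        rw [hsmul]
        simp [hσ, hβ, mul_assoc]
    let e := AddEquiv.ofBijective (coinvMul j) hbij
    refine ⟨T₀.comp e.symm.toAddMonoidHom, fun X v => ?_⟩
    have : e (MTP.mk ca X v) = unopTensor k P (ι X) * (1 ⊗ₜ[k] v) := rfl
    rw [← this]
    simp [T₀]

end IsESEmbedding

end EhresmannSchauenburg

end ComodAlg

namespace ComodAlg

noncomputable section Bisections

universe u v

open TensorProduct Coalgebra

variable {k : Type u} [Field k] {H P : Type v} [Ring H] [HopfAlgebra k H] [Ring P] [Algebra k P]
  {ca : ComodAlg k H P} {B0 L0 : Type v} [Ring B0] [Algebra k B0] [Ring L0] [Algebra k L0]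
  {ιB : B0 →ₐ[k] P} {ι : L0 →ₐ[k] P ⊗[k] Pᵐᵒᵖ} {st : BgdST k B0 L0}

/-- The map `p ⊗ q ↦ F(p) q` on `P ⊗ Pᵒᵖ`. -/
def gaugePairing (F : P →ₐ[k] P) : P ⊗[k] Pᵐᵒᵖ →ₗ[k] P :=
  pairing F (AlgHom.id k P) ∘ₗ (unopTensor k P).toLinearMap

@[simp] theorem gaugePairing_tmul (F : P →ₐ[k] P) (p : P) (q : Pᵐᵒᵖ) :
    gaugePairing F (p ⊗ₜ[k] q) = F p * q.unop := rfl

theorem gaugePairing_mul (F : P →ₐ[k] P) (x y : P ⊗[k] Pᵐᵒᵖ) : gaugePairing F (x * y) =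
    gaugePairing F (x * (1 ⊗ₜ[k] MulOpposite.op (gaugePairing F y))) := by
  induction y with
  | zero => simp
  | add y z hy hz => simp only [mul_add, map_add, TensorProduct.tmul_add,
      MulOpposite.op_add, hy, hz]
  | tmul r u =>
    induction x with
    | zero => simp
    | add y z hy hz => simp only [add_mul, map_add, hy, hz]
    | tmul p q => simp [mul_assoc]

theorem gaugePairing_op_mul (F : P →ₐ[k] P) (q : P) (x : P ⊗[k] Pᵐᵒᵖ) :
    gaugePairing F ((1 ⊗ₜ[k] MulOpposite.op q) * x) = gaugePairing F x * q := by
  induction x with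
  | zero => simp
  | tmul u v => simp [mul_assoc]
  | add y z hy hz => simp only [mul_add, add_mul, map_add, hy, hz]

theorem gaugePairing_tmul_mul (F : P →ₐ[k] P) (p : P) (x : P ⊗[k] Pᵐᵒᵖ) :
    gaugePairing F ((p ⊗ₜ[k] 1) * x) = F p * gaugePairing F x := by
  induction x with
  | zero => simp
  | tmul u v => simp [mul_assoc]
  | add y z hy hz => simp only [mul_add, map_add, hy, hz]

theorem gaugePairing_mul_tmul (F : P →ₐ[k] P) {p : P} (hp : F p = p) (x : P ⊗[k] Pᵐᵒᵖ) :
    gaugePairing F (x * (p ⊗ₜ[k] 1)) = gaugePairing F (x * (1 ⊗ₜ[k] MulOpposite.op p)) := by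
  induction x with
  | zero => simp
  | tmul u v => simp [hp, mul_assoc]
  | add y z hy hz => simp only [add_mul, map_add, hy, hz]

theorem map_pairing_firstHom_mul_legHom (F G : P →ₐ[k] P) (a b : P ⊗[k] H) :
    TensorProduct.map (pairing F G) LinearMap.id (firstHom k H P a * legHom k H P P b) =
      TensorProduct.map F.toLinearMap LinearMap.id a *
        TensorProduct.map G.toLinearMap LinearMap.id b := by
  induction a with
  | zero => simp
  | add y z hy hz => simp only [map_add, add_mul, hy, hz]
  | tmul u h =>
    induction b with
    | zero => simp
    | add y z hy hz => simp only [map_add, mul_add, hy, hz]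
    | tmul v g => simp

theorem IsGauge.coact_pairing {F : P →ₐ[k] P} (hF : IsGauge ca F) (z : P ⊗[k] P) :
    ca.ρ (pairing F (AlgHom.id k P) z) =
      TensorProduct.map (pairing F (AlgHom.id k P)) LinearMap.id (ca.diagCoact z) := by
  induction z with
  | zero => simp
  | add y z hy hz => simp only [map_add, hy, hz]
  | tmul p q =>
    rw [diagCoact_tmul, map_pairing_firstHom_mul_legHom, pairing_tmul, ca.coact_mul,
      hF.coact_apply]
    congr 1
    exact (LinearMap.congr_fun TensorProduct.map_id (ca.ρ q)).symm

/-- The functional `σ` on the Ehresmann–Schauenburg bialgebroid corresponds to the endomorphism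
`F` of `P`: it is given by `p ⊗ q ↦ F(p) q`. -/
def Corresponds (ιB : B0 →ₐ[k] P) (ι : L0 →ₐ[k] P ⊗[k] Pᵐᵒᵖ) (σ : L0 →ₗ[k] B0)
    (F : P →ₐ[k] P) : Prop :=
  ∀ X, ιB (σ X) = gaugePairing F (ι X)

namespace IsESEmbedding

theorem apply_base (hES : IsESEmbedding ca ιB ι st) {F : P →ₐ[k] P} (hF : IsGauge ca F) (b : B0) :
    F (ιB b) = ιB b :=
  hF.apply_coinv _ (hES.coact_base b)

theorem exists_corresponds (hES : IsESEmbedding ca ιB ι st) {F : P →ₐ[k] P} (hF : IsGauge ca F) :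
    ∃ σ : L0 →ₗ[k] B0, Corresponds ιB ι σ F := by
  have h : ∀ X, ∃ b, ιB b = gaugePairing F (ι X) := fun X => hES.exists_base <| by
    have := hF.coact_pairing (unopTensor k P (ι X))
    rw [hES.diagCoact_apply, TensorProduct.map_tmul] at this
    exact this
  choose σ hσ using h
  exact ⟨{ toFun := σ
           map_add' := fun X Y => hES.injective_base (by simp [hσ])
           map_smul' := fun r X => hES.injective_base (by simp [hσ]) }, hσ⟩

theorem eq_of_corresponds (hES : IsESEmbedding ca ιB ι st) {σ σ' : L0 →ₗ[k] B0} {F : P →ₐ[k] P}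
    (h : Corresponds ιB ι σ F) (h' : Corresponds ιB ι σ' F) : σ = σ' :=
  LinearMap.ext fun X => hES.injective_base ((h X).trans (h' X).symm)

theorem apply_s (hES : IsESEmbedding ca ιB ι st) {σ : L0 →ₗ[k] B0} {F : P →ₐ[k] P}
    (hF : IsGauge ca F) (h : Corresponds ιB ι σ F) (b : B0) : σ (st.s b) = b :=
  hES.injective_base <| by rw [h, hES.map_s]; simp [hES.apply_base hF]

theorem apply_t_mul_eq (hES : IsESEmbedding ca ιB ι st) {σ : L0 →ₗ[k] B0} {F : P →ₐ[k] P}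
    (h : Corresponds ιB ι σ F) (b : B0) (X : L0) : σ (st.t b * X) = σ X * b :=
  hES.injective_base <| by rw [h, map_mul ι, hES.map_t, gaugePairing_op_mul, map_mul ιB, h]

theorem isLeftBisection (hES : IsESEmbedding ca ιB ι st) {σ : L0 →ₗ[k] B0} {F : P →ₐ[k] P}
    (hF : IsGauge ca F) (h : Corresponds ιB ι σ F) : st.IsLeftBisection σ := by
  have hs : (fun b => σ (st.s b)) = id := funext (hES.apply_s hF h)
  have hprod : ∀ X Y, σ (X * Y) = σ (X * st.t (σ Y)) := fun X Y => hES.injective_base <| by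
    rw [h, h, map_mul ι, map_mul ι, hES.map_t, h, gaugePairing_mul]
  refine ⟨hES.injective_base ?_, hES.apply_t_mul_eq h, fun a b => ?_, ?_, hprod, fun X Y => ?_⟩
  · rw [h]; simp [Algebra.TensorProduct.one_def]
  · simp only [hES.apply_s hF h]
  · rw [hs]; exact Function.bijective_id
  · have hinv : Function.invFun (fun b => σ (st.s b)) (σ Y) = σ Y := by
      rw [hs]; exact Function.leftInverse_invFun Function.injective_id _
    rw [hinv, hprod]
    apply hES.injective_base
    rw [h, h, map_mul ι, map_mul ι, hES.map_s, hES.map_t, MulOpposite.op_one,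
      gaugePairing_mul_tmul F (hES.apply_base hF _)]

theorem algHom_eq_of_corresponds (hES : IsESEmbedding ca ιB ι st) (hGal : ca.IsGalois)
    (hFF : ca.IsFaithfullyFlat) {σ : L0 →ₗ[k] B0} {F F' : P →ₐ[k] P}
    (h : Corresponds ιB ι σ F) (h' : Corresponds ιB ι σ F') : F = F' := by
  have key : ∀ z, pairing F (AlgHom.id k P) z = pairing F' (AlgHom.id k P) z := by
    refine (hES.descent hGal hFF).1 _ (by simp) (fun X v => ?_) fun y z hy hz => by
      rw [map_add, map_add, hy, hz]
    rw [pairing_mul_one_tmul, pairing_mul_one_tmul]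
    exact congrArg (· * v) ((h X).symm.trans (h' X))
  ext p
  simpa using key (p ⊗ₜ[k] 1)

theorem exists_isGauge (hES : IsESEmbedding ca ιB ι st) (hGal : ca.IsGalois)
    (hFF : ca.IsFaithfullyFlat) {σ : L0 →ₗ[k] B0}
    (hσ : st.IsLeftBisection σ) (hσs : ∀ b, σ (st.s b) = b) :
    ∃ F, IsGauge ca F ∧ Corresponds ιB ι σ F := by
  obtain ⟨hind, hlift⟩ := hES.descent hGal hFF
  obtain ⟨T, hT⟩ := hlift σ hσ.t_prop
  have hinv : ∀ b, Function.invFun (fun b => σ (st.s b)) b = b := fun b => by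
    rw [show (fun b => σ (st.s b)) = id from funext hσs]
    exact Function.leftInverse_invFun Function.injective_id _
  have hσs_mul : ∀ b X, σ (st.s b * X) = b * σ X := fun b X => by
    rw [hσ.prod_s, hinv, ← map_mul, hσs]
  have hTι : ∀ X, T (unopTensor k P (ι X)) = ιB (σ X) := fun X => by
    simpa [← Algebra.TensorProduct.one_def] using hT X 1
  have hT_mul : ∀ z v, T (z * (1 ⊗ₜ[k] v)) = T z * v := fun z v => by
    revert z
    refine hind _ (by simp) (fun X u => ?_) fun y z hy hz => by
      rw [add_mul, map_add, hy, hz, map_add, add_mul]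
    rw [mul_assoc, Algebra.TensorProduct.tmul_mul_tmul, one_mul, hT, hT, mul_assoc]
  have hT_smul : ∀ (r : k) z, T (r • z) = r • T z := fun r z => by
    have : r • z = z * (1 ⊗ₜ[k] (r • 1)) := by
      rw [TensorProduct.tmul_smul, ← Algebra.TensorProduct.one_def, mul_smul_comm, mul_one]
    rw [this, hT_mul, mul_smul_comm, mul_one]
  let T' : P ⊗[k] P →ₗ[k] P := { T with map_smul' := hT_smul }
  have hT' : ∀ z, T' z = T z := fun _ => rfl
  have hT_base : ∀ b z, T ((ιB b ⊗ₜ[k] 1) * z) = ιB b * T z := fun b => by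
    refine hind _ (by simp) (fun X u => ?_) fun y z hy hz => by
      rw [mul_add, map_add, hy, hz, map_add, mul_add]
    rw [← mul_assoc, ← hES.apply_s_mul, hT, hT, hσs_mul, map_mul, mul_assoc]
  have hT_one : T 1 = 1 := by
    have := hTι 1
    rw [hσ.unital, map_one ι, map_one ιB] at this
    exact this
  have hT_op : ∀ Y x, T (unopTensor k P (x * ι Y)) = T ((1 ⊗ₜ[k] ιB (σ Y)) * unopTensor k P x) :=
    fun Y x => by
      suffices ∀ z, T (unopTensor k P ((unopTensor k P).symm z * ι Y)) =
          T ((1 ⊗ₜ[k] ιB (σ Y)) * z) by simpa using this (unopTensor k P x)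
      refine hind _ (by simp) (fun X u => ?_) fun y z hy hz => by
        rw [map_add, add_mul, map_add, map_add, hy, hz, mul_add, map_add]
      rw [← unopTensor_op_mul, LinearEquiv.symm_apply_apply, mul_assoc, unopTensor_op_mul,
        unopTensor_op_mul, ← map_mul, hT, hσ.prod_t, ← mul_assoc, ← hES.apply_mul_t, hT]
  have hT_left : ∀ p z, T ((p ⊗ₜ[k] 1) * z) = T (p ⊗ₜ[k] 1) * T z := fun p => by
    refine hind _ (by simp) (fun X u => ?_) fun y z hy hz => by
      rw [mul_add, map_add, hy, hz, map_add, mul_add]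
    rw [← mul_assoc, hT_mul, hT_mul, hTι, ← unopTensor_tmul_one_mul, hT_op, ← hT_mul, ← hT_mul]
    simp
  have hρ : ∀ z, ca.ρ (T z) = TensorProduct.map T' LinearMap.id (ca.diagCoact z) := by
    refine hind _ (by simp) (fun X v => ?_) fun y z hy hz => by
      simp only [map_add, hy, hz]
    rw [hT, ca.coact_mul, hES.coact_base, diagCoact_mul, hES.diagCoact_apply]
    induction ca.ρ v with
    | zero => simp
    | add y z hy hz => simp only [map_add, mul_add, hy, hz]
    | tmul w h => simp [hT', hT]
  let F : P →ₐ[k] P := AlgHom.ofLinearMap (T' ∘ₗ (TensorProduct.mk k P P).flip 1) hT_one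
    fun p q => by
      change T ((p * q) ⊗ₜ[k] 1) = T (p ⊗ₜ[k] 1) * T (q ⊗ₜ[k] 1)
      rw [← hT_left, Algebra.TensorProduct.tmul_mul_tmul, mul_one]
  have hF : ∀ p, F p = T (p ⊗ₜ[k] 1) := fun _ => rfl
  refine ⟨F, ⟨fun p hp => ?_, fun p => ?_⟩, fun X => ?_⟩
  · obtain ⟨b, rfl⟩ := hES.exists_base hp
    rw [hF]
    simpa [hT_one] using hT_base b 1
  · rw [hF, hρ, diagCoact_tmul, ca.coact_one, map_one, mul_one]
    induction ca.ρ p with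
    | zero => simp
    | add y z hy hz => simp only [map_add, hy, hz]
    | tmul w h => simp [hT', hF]
  · rw [← hTι]
    change T (unopTensor k P (ι X)) = pairing F (AlgHom.id k P) (unopTensor k P (ι X))
    induction unopTensor k P (ι X) with
    | zero => simp
    | add y z hy hz => simp only [map_add, hy, hz]
    | tmul p q =>
      rw [pairing_tmul, hF, AlgHom.id_apply, ← hT_mul]
      simp

end IsESEmbedding

end Bisections

end ComodAlg

namespace ComodAlg

noncomputable section Convolution

universe u v

open TensorProduct Coalgebra

variable {k : Type u} [Field k] {H P : Type v} [Ring H] [HopfAlgebra k H] [Ring P] [Algebra k P]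
  {ca : ComodAlg k H P} {B0 L0 : Type v} [Ring B0] [Algebra k B0] [Ring L0] [Algebra k L0]
  {ιB : B0 →ₐ[k] P} {ι : L0 →ₐ[k] P ⊗[k] Pᵐᵒᵖ} {st : BgdST k B0 L0}

variable (ca) in
/-- The multiplication `P ⊗_B P → P`. -/
def mulPBP : ca.PBP →ₗ[k] P :=
  (TensorProduct.rid k P).toLinearMap ∘ₗ TensorProduct.map LinearMap.id counit ∘ₗ ca.chi

theorem mulPBP_mk_tmul (u v : P) :
    ca.mulPBP (Submodule.Quotient.mk (u ⊗ₜ[k] v)) = u * v := by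
  have h : ∀ z : P ⊗[k] H, TensorProduct.rid k P (TensorProduct.map LinearMap.id counit
      ((u ⊗ₜ[k] 1) * z)) = u * TensorProduct.rid k P (TensorProduct.map LinearMap.id counit z) := by
    intro z
    induction z with
    | zero => simp
    | tmul w h => simp
    | add y z hy hz => simp only [mul_add, map_add, hy, hz]
  simp only [mulPBP, LinearMap.comp_apply, LinearEquiv.coe_coe, chi_mk_tmul, h, map_counit_coact]

theorem mulPBP_tau (hGal : ca.IsGalois) (h : H) :
    ca.mulPBP (ca.tau h) = algebraMap k P (counit h) := by
  simp [mulPBP, tau_eq_tauHom hGal, chi_tauHom, Algebra.algebraMap_eq_smul_one]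

/-- The bilinear form `(p ⊗ u, v ⊗ q) ↦ F(G(p) u) F(v) q`. -/
def gaugeForm (F G : P →ₐ[k] P) : P ⊗[k] Pᵐᵒᵖ →ₗ[k] P ⊗[k] Pᵐᵒᵖ →ₗ[k] P :=
  (LinearMap.mul k P).compl₁₂ (F.toLinearMap ∘ₗ gaugePairing G) (gaugePairing F)

@[simp] theorem gaugeForm_apply (F G : P →ₐ[k] P) (x y : P ⊗[k] Pᵐᵒᵖ) :
    gaugeForm F G x y = F (gaugePairing G x) * gaugePairing F y := rfl

theorem esDeltaEval_gaugeForm (hGal : ca.IsGalois) (F G : P →ₐ[k] P) :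
    ca.esDeltaEval (fun x y => gaugeForm F G x y) = gaugePairing (F.comp G) := by
  refine tlift_eq_of_forall _ fun p q => ?_
  rw [tlift_eq_of_forall (LinearMap.mulRight k q.unop ∘ₗ (F.comp G).toLinearMap ∘ₗ
    (TensorProduct.rid k P).toLinearMap ∘ₗ TensorProduct.map LinearMap.id counit)]
  · simp [map_counit_coact]
  · intro p0 p1
    rw [qtlift_eq_of_forall (LinearMap.mulRight k q.unop ∘ₗ LinearMap.mulLeft k (F (G p0)) ∘ₗ
      F.toLinearMap ∘ₗ ca.mulPBP)]
    · simp [mulPBP_tau hGal, Algebra.algebraMap_eq_smul_one]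
    · intro u v
      simp [mulPBP_mk_tmul, mul_assoc]

theorem IsESEmbedding.corresponds_bconv (hES : IsESEmbedding ca ιB ι st) (hGal : ca.IsGalois)
    {cop : L0 →ₗ[k] st.T2}
    (hcop : ∀ (V : Type v) [AddCommGroup V] [Module k V]
      (G : (P ⊗[k] Pᵐᵒᵖ) →ₗ[k] (P ⊗[k] Pᵐᵒᵖ) →ₗ[k] V),
      (∀ (b : B0) (X Y : P ⊗[k] Pᵐᵒᵖ),
        G ((1 ⊗ₜ[k] MulOpposite.op (ιB b)) * X) Y = G X ((ιB b ⊗ₜ[k] MulOpposite.op 1) * Y)) →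
      ∀ z : L0, st.lift2 (fun x y => G (ι x) (ι y)) (cop z) =
        ca.esDeltaEval (fun x y => G x y) (ι z))
    {σ τ : L0 →ₗ[k] B0} {F G : P →ₐ[k] P} (hσ : Corresponds ιB ι σ F)
    (hτ : Corresponds ιB ι τ G) :
    Corresponds ιB ι (st.bconv cop σ τ) (F.comp G) := by
  intro X
  have hform := hcop P (gaugeForm F G) (fun b X Y => by
    rw [gaugeForm_apply, gaugeForm_apply, gaugePairing_op_mul, MulOpposite.op_one,
      gaugePairing_tmul_mul, map_mul, mul_assoc]) X
  rw [esDeltaEval_gaugeForm hGal] at hform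
  rw [← hform]
  let M : L0 ⊗[k] L0 →ₗ[k] B0 := σ ∘ₗ LinearMap.mul' k L0 ∘ₗ
    TensorProduct.map (st.s.toLinearMap ∘ₗ τ) LinearMap.id
  have hM : ∀ x y, M (x ⊗ₜ[k] y) = σ (st.s (τ x) * y) := fun _ _ => rfl
  have hle : st.rel ≤ LinearMap.ker M := by
    refine Submodule.span_le.2 ?_
    rintro _ ⟨b, x, y, rfl⟩
    rw [SetLike.mem_coe, LinearMap.mem_ker, map_sub, hM, hM, hES.apply_t_mul_eq hτ,
      map_mul st.s, mul_assoc, sub_self]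
  rw [BgdST.bconv, LinearMap.comp_apply, BgdST.lift2, BgdST.lift2,
    qtlift_eq_of_forall (st.rel.liftQ M hle) hM,
    qtlift_eq_of_forall (ιB.toLinearMap ∘ₗ st.rel.liftQ M hle)]
  · rfl
  · intro x y
    change ιB (σ (st.s (τ x) * y)) = _
    rw [hσ, map_mul, hES.map_s, MulOpposite.op_one, gaugePairing_tmul_mul, hτ, gaugeForm_apply]

end Convolution

end ComodAlg

namespace ComodAlg

section Isomorphism

universe u v

open TensorProduct Coalgebra

variable {k : Type u} [Field k] {H P : Type v} [Ring H] [HopfAlgebra k H] [Ring P] [Algebra k P]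
  {ca : ComodAlg k H P} {B0 L0 : Type v} [Ring B0] [Algebra k B0] [Ring L0] [Algebra k L0]
  {ιB : B0 →ₐ[k] P} {ι : L0 →ₐ[k] P ⊗[k] Pᵐᵒᵖ} {st : BgdST k B0 L0}

/-- The functional `σ` and the map `g : H → P` come from the same gauge transformation `F`, where
`F` is given by `p ↦ p₍₀₎ f(p₍₁₎)` for the convolution inverse `f` of `g`. -/
def Associated (ca : ComodAlg k H P) (ιB : B0 →ₐ[k] P) (ι : L0 →ₐ[k] P ⊗[k] Pᵐᵒᵖ)
    (σ : L0 →ₗ[k] B0) (g : H →ₗ[k] P) : Prop :=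
  ∃ (F : P →ₐ[k] P) (f : H →ₗ[k] P), IsGauge ca F ∧ Corresponds ιB ι σ F ∧
    F.toLinearMap = ca.act LinearMap.id f ∧ conv f g = convUnit ∧ conv g f = convUnit

theorem conv_inverse_unique {R : Type*} [Ring R] [Algebra k R] {f g g' : H →ₗ[k] R}
    (h : conv g f = convUnit) (h' : conv f g' = convUnit) : g = g' := by
  rw [← conv_unit g, ← h', ← conv_assoc, h, unit_conv]

namespace Associated

theorem left_unique (hES : IsESEmbedding ca ιB ι st) {σ σ' : L0 →ₗ[k] B0} {g : H →ₗ[k] P}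
    (h : Associated ca ιB ι σ g) (h' : Associated ca ιB ι σ' g) : σ = σ' := by
  obtain ⟨F, f, -, hσ, hFf, hfg, -⟩ := h
  obtain ⟨F', f', -, hσ', hFf', -, hgf'⟩ := h'
  obtain rfl : f = f' := conv_inverse_unique hfg hgf'
  obtain rfl : F = F' := AlgHom.toLinearMap_injective (hFf.trans hFf'.symm)
  exact hES.eq_of_corresponds hσ hσ'

theorem right_unique (hES : IsESEmbedding ca ιB ι st) (hGal : ca.IsGalois)
    (hFF : ca.IsFaithfullyFlat) {σ : L0 →ₗ[k] B0} {g g' : H →ₗ[k] P}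
    (h : Associated ca ιB ι σ g) (h' : Associated ca ιB ι σ g') : g = g' := by
  obtain ⟨F, f, -, hσ, hFf, -, hgf⟩ := h
  obtain ⟨F', f', -, hσ', hFf', hfg', -⟩ := h'
  obtain rfl : F = F' := hES.algHom_eq_of_corresponds hGal hFF hσ hσ'
  obtain rfl : f = f' := act_injective hGal (AlgHom.id k P) (hFf.symm.trans hFf')
  exact conv_inverse_unique hgf hfg'

theorem exists_right (hES : IsESEmbedding ca ιB ι st) (hGal : ca.IsGalois)
    (hFF : ca.IsFaithfullyFlat) {σ : L0 →ₗ[k] B0} (hσ : st.IsLeftBisection σ)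
    (hσs : ∀ b, σ (st.s b) = b) : ∃ g, IsZt1 ca g ∧ Associated ca ιB ι σ g := by
  obtain ⟨F, hF, hσF⟩ := hES.exists_isGauge hGal hFF hσ hσs
  obtain ⟨f, hf, hFf⟩ := hF.exists_isZt1 hGal
  obtain ⟨g, hg, hfg, hgf, -⟩ := hf.exists_inverse hGal
  exact ⟨g, hg, F, f, hF, hσF, hFf, hfg, hgf⟩

theorem exists_left (hES : IsESEmbedding ca ιB ι st) (hGal : ca.IsGalois) {g : H →ₗ[k] P}
    (hg : IsZt1 ca g) :
    ∃ σ : L0 →ₗ[k] B0, (st.IsLeftBisection σ ∧ ∀ b, σ (st.s b) = b) ∧ Associated ca ιB ι σ g := by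
  obtain ⟨f, hf, hgf, hfg, -⟩ := hg.exists_inverse hGal
  obtain ⟨F, hF, hFf⟩ := (isZt1_iff hGal f).1 hf
  obtain ⟨σ, hσ⟩ := hES.exists_corresponds hF
  exact ⟨σ, ⟨hES.isLeftBisection hF hσ, hES.apply_s hF hσ⟩, F, f, hF, hσ, hFf, hfg, hgf⟩

theorem bconv (hES : IsESEmbedding ca ιB ι st) (hGal : ca.IsGalois) {cop : L0 →ₗ[k] st.T2}
    (hcop : ∀ (V : Type v) [AddCommGroup V] [Module k V]
      (G : (P ⊗[k] Pᵐᵒᵖ) →ₗ[k] (P ⊗[k] Pᵐᵒᵖ) →ₗ[k] V),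
      (∀ (b : B0) (X Y : P ⊗[k] Pᵐᵒᵖ),
        G ((1 ⊗ₜ[k] MulOpposite.op (ιB b)) * X) Y = G X ((ιB b ⊗ₜ[k] MulOpposite.op 1) * Y)) →
      ∀ z : L0, st.lift2 (fun x y => G (ι x) (ι y)) (cop z) =
        ca.esDeltaEval (fun x y => G x y) (ι z))
    {σ σ' : L0 →ₗ[k] B0} {g g' : H →ₗ[k] P} (h : Associated ca ιB ι σ g)
    (h' : Associated ca ιB ι σ' g') : Associated ca ιB ι (st.bconv cop σ σ') (conv g g') := by
  obtain ⟨F, f, hF, hσ, hFf, hfg, hgf⟩ := h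
  obtain ⟨F', f', hF', hσ', hFf', hfg', hgf'⟩ := h'
  have cancel : ∀ {a b c d : H →ₗ[k] P}, conv b c = convUnit → conv a d = convUnit →
      conv (conv a b) (conv c d) = convUnit := fun {a b c d} hbc had => by
    rw [conv_assoc, ← conv_assoc b, hbc, unit_conv, had]
  exact ⟨F.comp F', conv f' f, hF.comp hF', hES.corresponds_bconv hGal hcop hσ hσ',
    hF'.toLinearMap_comp hFf' hFf, cancel hfg hfg', cancel hgf' hgf⟩

end Associated

end Isomorphism

end ComodAlg

/-- For a faithfully flat Hopf–Galois extension `B = P^{coH} ⊆ P`, the set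
`Z̃¹(H,P)` is a group under convolution with the stated inverse
`f⁻¹(h) = τ(h₍₂₎)⁽¹⁾ f(Sh₍₁₎) τ(h₍₂₎)⁽²⁾`, and `Z¹(L(P,H),B) ≅ Z̃¹(H,P)` as groups, where
`Z¹(L(P,H),B)` is the group of vertical bisections. -/
theorem vertical_bisections_iso_Zt1
    {k : Type u} [Field k] {H P : Type v} [Ring H] [HopfAlgebra k H] [Ring P] [Algebra k P]
    (ca : ComodAlg k H P) (hGal : ca.IsGalois) (hFF : ca.IsFaithfullyFlat)
    {B0 L0 : Type v} [Ring B0] [Algebra k B0] [Ring L0] [Algebra k L0]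
    (ιB : B0 →ₐ[k] P) (hιB : Function.Injective ιB)
    (hιBrange : Set.range ιB = {p : P | ca.ρ p = p ⊗ₜ[k] (1 : H)})
    (ι : L0 →ₐ[k] (P ⊗[k] Pᵐᵒᵖ)) (hι : Function.Injective ι)
    (hιrange : Set.range ι = {z : P ⊗[k] Pᵐᵒᵖ | ca.betaA z = z ⊗ₜ[k] (1 : H)})
    (st : BgdST k B0 L0) (cop : L0 →ₗ[k] st.T2) (cou : L0 →ₗ[k] B0)
    (hbgd : st.IsLeftBialgebroid cop cou)
    (hs : ∀ b : B0, ι (st.s b) = (ιB b) ⊗ₜ[k] MulOpposite.op (1 : P))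
    (ht : ∀ b : B0, ι (st.t b) = (1 : P) ⊗ₜ[k] MulOpposite.op (ιB b))
    (hcou : ∀ z : L0, ιB (cou z) = ComodAlg.mulA (ι z))
    (hcop : ∀ (V : Type v) [AddCommGroup V] [Module k V]
      (G : (P ⊗[k] Pᵐᵒᵖ) →ₗ[k] (P ⊗[k] Pᵐᵒᵖ) →ₗ[k] V),
      (∀ (b : B0) (X Y : P ⊗[k] Pᵐᵒᵖ),
        G ((((1 : P) ⊗ₜ[k] MulOpposite.op (ιB b)) : P ⊗[k] Pᵐᵒᵖ) * X) Y =
          G X ((((ιB b) ⊗ₜ[k] MulOpposite.op (1 : P)) : P ⊗[k] Pᵐᵒᵖ) * Y)) →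
      ∀ z : L0, st.lift2 (fun x y => G (ι x) (ι y)) (cop z) =
        ca.esDeltaEval (fun x y => G x y) (ι z)) :
    (∀ f g : H →ₗ[k] P, ComodAlg.IsZt1 ca f → ComodAlg.IsZt1 ca g →
      ComodAlg.IsZt1 ca (ComodAlg.convH f g)) ∧
    ComodAlg.IsZt1 ca ComodAlg.unitH ∧
    (∀ f g h' : H →ₗ[k] P, ComodAlg.IsZt1 ca f → ComodAlg.IsZt1 ca g → ComodAlg.IsZt1 ca h' →
      ComodAlg.convH (ComodAlg.convH f g) h' = ComodAlg.convH f (ComodAlg.convH g h')) ∧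
    (∀ f : H →ₗ[k] P, ComodAlg.IsZt1 ca f →
      ComodAlg.convH f ComodAlg.unitH = f ∧ ComodAlg.convH ComodAlg.unitH f = f) ∧
    (∀ f : H →ₗ[k] P, ComodAlg.IsZt1 ca f → ∃ g : H →ₗ[k] P, ComodAlg.IsZt1 ca g ∧
      ComodAlg.convH f g = ComodAlg.unitH ∧ ComodAlg.convH g f = ComodAlg.unitH ∧
      (∀ (h : H) (c : H ⊗[k] (P ⊗[k] P)),
        TensorProduct.map LinearMap.id (Submodule.mkQ ca.relB) c = ComodAlg.tauLeg ca h →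
        g h = ComodAlg.evalMid (⇑f) c)) ∧
    (∃ e : {σ : L0 →ₗ[k] B0 // st.IsLeftBisection σ ∧ ∀ b : B0, σ (st.s b) = b} ≃
        {f : H →ₗ[k] P // ComodAlg.IsZt1 ca f},
      ∀ s1 s2 s3 : {σ : L0 →ₗ[k] B0 // st.IsLeftBisection σ ∧ ∀ b : B0, σ (st.s b) = b},
        s3.1 = st.bconv cop s1.1 s2.1 →
        ((e s3).1 : H →ₗ[k] P) = ComodAlg.convH (e s1).1 (e s2).1) := by
  have hES : ComodAlg.IsESEmbedding ca ιB ι st := ⟨hιB, hιBrange, hι, hιrange, hs, ht⟩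
  simp only [ComodAlg.convH_eq]
  refine ⟨fun f g hf hg => ComodAlg.isZt1_conv hGal hf hg, ComodAlg.isZt1_unit hGal,
    fun f g h' _ _ _ => ComodAlg.conv_assoc f g h',
    fun f _ => ⟨ComodAlg.conv_unit f, ComodAlg.unit_conv f⟩,
    fun f hf => hf.exists_inverse hGal, ?_⟩
  choose e he hassoc using fun σ : {σ : L0 →ₗ[k] B0 // st.IsLeftBisection σ ∧
    ∀ b : B0, σ (st.s b) = b} => ComodAlg.Associated.exists_right hES hGal hFF σ.2.1 σ.2.2
  refine ⟨Equiv.ofBijective (fun σ => ⟨e σ, he σ⟩) ⟨fun σ σ' h => Subtype.ext ?_, fun g => ?_⟩,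
    fun s1 s2 s3 h => ?_⟩
  · have hee : e σ = e σ' := congrArg Subtype.val h
    exact (hassoc σ).left_unique hES (hee ▸ hassoc σ')
  · obtain ⟨σ, hσ, hσg⟩ := ComodAlg.Associated.exists_left (st := st) hES hGal g.2
    exact ⟨⟨σ, hσ⟩, Subtype.ext ((hassoc ⟨σ, hσ⟩).right_unique hES hGal hFF hσg)⟩
  · have h3 := hassoc s3
    rw [h] at h3
    exact h3.right_unique hES hGal hFF ((hassoc s1).bconv hES hGal hcop (hassoc s2))
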